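/- Let A = KQ/I be a geometrically irreducible finite-dimensional algebra over an algebraically closed field K, where Q is a finite quiver and I is an admissible ideal of KQ. Then every rigid finite-dimensional A-module is locally free, i.e. if M is a finite-dimensional A-module with Ext^1_A(M,M) = 0, then for every vertex i of Q the e_iAe_i-module e_iM is free. -/

import Mathlib

open scoped BigOperators

noncomputable section
/-! ## Quivers and paths -/

/-- A finite quiver: finite sets of vertices and arrows together with source and
target maps. -/
structure FinQuiver : Type 1 where
  V : Type
  A : Type
  [fintypeV : Fintype V]
  [fintypeA : Fintype A]
  [decEqV : DecidableEq V]
  [decEqA : DecidableEq A]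
  src : A → V
  tgt : A → V

attribute [instance] FinQuiver.fintypeV FinQuiver.fintypeA FinQuiver.decEqV FinQuiver.decEqA

/-- A path of positive length in a quiver: a list of composable arrows `[a₁, …, aₘ]`
satisfying `s (aᵢ) = t (aᵢ₊₁)`. -/
structure QPath (Q : FinQuiver) : Type where
  arrows : List Q.A
  ne : arrows ≠ []
  chain : arrows.Chain' fun a b => Q.src a = Q.tgt b

namespace QPath

variable {Q : FinQuiver}

/-- The length of a path. -/
def length (p : QPath Q) : ℕ := p.arrows.length

/-- The target `t (a₁)` of a path `(a₁, …, aₘ)`. -/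
def tgt (p : QPath Q) : Q.V := Q.tgt (p.arrows.head p.ne)

/-- The source `s (aₘ)` of a path `(a₁, …, aₘ)`. -/
def src (p : QPath Q) : Q.V := Q.src (p.arrows.getLast p.ne)

/-- A path is a cycle if its source equals its target. -/
def IsCycle (p : QPath Q) : Prop := p.src = p.tgt

/-- A cycle `(a₁, …, aₘ)` is primitive if the vertices `s (a₁), …, s (aₘ)` are pairwise
different. -/
def IsPrimitive (p : QPath Q) : Prop := (p.arrows.map Q.src).Nodup

end QPath

/-! ## The path algebra, relations, admissible ideals and representation varieties -/

/-- The defining relations presenting the path algebra `KQ` as a quotient of the free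
algebra on the vertices and arrows of `Q`: the vertices become a complete set of
orthogonal idempotents summing to `1`, and `e_{t(a)} * a = a = a * e_{s(a)}` for every
arrow `a`. -/
inductive PathRel (K : Type) [Field K] (Q : FinQuiver) :
    FreeAlgebra K (Q.V ⊕ Q.A) → FreeAlgebra K (Q.V ⊕ Q.A) → Prop
  | idem (i : Q.V) : PathRel K Q
      (FreeAlgebra.ι K (Sum.inl i) * FreeAlgebra.ι K (Sum.inl i)) (FreeAlgebra.ι K (Sum.inl i))
  | orth (i j : Q.V) (h : i ≠ j) : PathRel K Q
      (FreeAlgebra.ι K (Sum.inl i) * FreeAlgebra.ι K (Sum.inl j)) 0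
  | sum_one : PathRel K Q (∑ i : Q.V, FreeAlgebra.ι K (Sum.inl i)) 1
  | tgt_mul (a : Q.A) : PathRel K Q
      (FreeAlgebra.ι K (Sum.inl (Q.tgt a)) * FreeAlgebra.ι K (Sum.inr a))
      (FreeAlgebra.ι K (Sum.inr a))
  | mul_src (a : Q.A) : PathRel K Q
      (FreeAlgebra.ι K (Sum.inr a) * FreeAlgebra.ι K (Sum.inl (Q.src a)))
      (FreeAlgebra.ι K (Sum.inr a))

/-- The path algebra `KQ`. -/
abbrev PathAlgebra (K : Type) [Field K] (Q : FinQuiver) : Type := RingQuot (PathRel K Q)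

variable (K : Type) [Field K] (Q : FinQuiver)

/-- The idempotent `eᵢ ∈ KQ` corresponding to a vertex `i` (the path of length zero
at `i`). -/
def vertexElem (i : Q.V) : PathAlgebra K Q :=
  RingQuot.mkAlgHom K (PathRel K Q) (FreeAlgebra.ι K (Sum.inl i))

/-- The element of `KQ` corresponding to an arrow `a`. -/
def arrowElem (a : Q.A) : PathAlgebra K Q :=
  RingQuot.mkAlgHom K (PathRel K Q) (FreeAlgebra.ι K (Sum.inr a))

/-- The element of `KQ` corresponding to a path `(a₁, …, aₘ)`, namely `a₁ ⋯ aₘ`. -/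
def pathElem (p : QPath Q) : PathAlgebra K Q := (p.arrows.map (arrowElem K Q)).prod

/-- The element `∑ₚ c p • p` of `KQ` determined by a finitely supported family of
coefficients on paths. -/
def relElem (c : QPath Q →₀ K) : PathAlgebra K Q := c.sum fun p l => l • pathElem K Q p

/-- `c` is the datum of a relation with common target `i` and common source `j`: all
paths in its support have length at least two, target `i` and source `j`.  (The paths in
the support are pairwise different and have nonzero coefficients by definition of a
finitely supported function.) -/
def IsRelationData (c : QPath Q →₀ K) (i j : Q.V) : Prop :=
  ∀ p ∈ c.support, 2 ≤ p.length ∧ p.tgt = i ∧ p.src = j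

/-- An element of `KQ` is a relation if it is a `K`-linear combination `∑ λₚ • p` of
pairwise different paths of length at least two having a common source and a common
target, with all `λₚ ≠ 0`. -/
def IsRelation (x : PathAlgebra K Q) : Prop :=
  ∃ (c : QPath Q →₀ K) (i j : Q.V), IsRelationData K Q c i j ∧ x = relElem K Q c

/-- The two-sided ideal generated by a set `S`, as a set: the additive subgroup generated
by all elements `a * s * b` with `s ∈ S`. -/
def twoSidedSpan (R : Type) [Ring R] (S : Set R) : Set R :=
  (AddSubgroup.closure {x | ∃ a b : R, ∃ s ∈ S, x = a * s * b} : AddSubgroup R)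

/-- `φ : KQ →ₐ[K] A` presents `A` as `KQ/I` with `I = ker φ` an admissible ideal:
`φ` is surjective, its kernel is generated (as a two-sided ideal) by a set of relations,
and there is some `m ≥ 2` such that all paths of length at least `m` lie in the kernel. -/
def IsAdmissiblePresentation {A : Type} [Ring A] [Algebra K A]
    (φ : PathAlgebra K Q →ₐ[K] A) : Prop :=
  Function.Surjective φ ∧
  (∃ S : Set (PathAlgebra K Q), (∀ x ∈ S, IsRelation K Q x) ∧
    twoSidedSpan (PathAlgebra K Q) S = {x | φ x = 0}) ∧
  ∃ m : ℕ, 2 ≤ m ∧ ∀ p : QPath Q, m ≤ p.length → φ (pathElem K Q p) = 0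

/-- The index type for the rows/columns of the matrices in a `d`-dimensional
representation: the basis vectors of `⊕ᵢ K^{dᵢ}`. -/
abbrev RepIx (d : Q.V → ℕ) : Type := (i : Q.V) × Fin (d i)

/-- The ambient affine space of `d`-dimensional representations.  An arrow `a` gets a
matrix; membership in `RepSet` forces the matrix of `a` to be concentrated in the block
with rows indexed by the block `t(a)` and columns indexed by the block `s(a)`, i.e. to be
(the block extension of) a `d (t a) × d (s a)`-matrix. -/
abbrev RepSpace (d : Q.V → ℕ) : Type := Q.A → Matrix (RepIx Q d) (RepIx Q d) K

/-- The Zariski topology on affine space `K^ι`: generated by the complements of zero sets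
of polynomials in the coordinates. -/
def zariskiTopology (ι R : Type) [CommSemiring R] : TopologicalSpace (ι → R) :=
  TopologicalSpace.generateFrom
    {U | ∃ f : MvPolynomial ι R, U = {x | MvPolynomial.eval x f ≠ 0}}

/-- The Zariski topology on the ambient space of `d`-dimensional representations. -/
def repTopology (d : Q.V → ℕ) : TopologicalSpace (RepSpace K Q d) :=
  TopologicalSpace.induced (fun M (x : Q.A × RepIx Q d × RepIx Q d) => M x.1 x.2.1 x.2.2)
    (zariskiTopology (Q.A × RepIx Q d × RepIx Q d) K)

/-- The condition that the matrix of each arrow `a` is concentrated in the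
`(t a, s a)`-block, i.e. really is a `d (t a) × d (s a)`-matrix. -/
def BlockCompatible (d : Q.V → ℕ) (M : RepSpace K Q d) : Prop :=
  ∀ (a : Q.A) (u v : RepIx Q d), M a u v ≠ 0 → u.1 = Q.tgt a ∧ v.1 = Q.src a

/-- The evaluation `M(p) = M(a₁) ⋯ M(aₘ)` of a representation at a path. -/
def pathProd (d : Q.V → ℕ) (M : RepSpace K Q d) (p : QPath Q) :
    Matrix (RepIx Q d) (RepIx Q d) K := (p.arrows.map M).prod

/-- The evaluation `M(ρ) = ∑ λₚ M(p)` of a representation at a linear combination of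
paths. -/
def relEval (d : Q.V → ℕ) (M : RepSpace K Q d) (c : QPath Q →₀ K) :
    Matrix (RepIx Q d) (RepIx Q d) K := c.sum fun p l => l • pathProd K Q d M p

/-- The affine variety `rep(A, d)` of `d`-dimensional representations of `A = KQ/I`,
where `I = ker φ`: tuples of matrices (of the correct block sizes) with `M(ρ) = 0` for
every relation `ρ ∈ I`. -/
def RepSet {A : Type} [Ring A] [Algebra K A] (φ : PathAlgebra K Q →ₐ[K] A) (d : Q.V → ℕ) :
    Set (RepSpace K Q d) :=
  {M | BlockCompatible K Q d M ∧
    ∀ (c : QPath Q →₀ K) (i j : Q.V), IsRelationData K Q c i j →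
      φ (relElem K Q c) = 0 → relEval K Q d M c = 0}

/-- `A = KQ/I` (presented by `φ`, with `I = ker φ`) is geometrically irreducible if
`rep(A, d)` is an irreducible topological space for every dimension vector `d`. -/
def IsGeomIrreducible {A : Type} [Ring A] [Algebra K A] (φ : PathAlgebra K Q →ₐ[K] A) :
    Prop :=
  ∀ d : Q.V → ℕ, @IsIrreducible _ (repTopology K Q d) (RepSet K Q φ d)

/-! ## Rigid modules -/

/-- `Ext¹_A(M, M) = 0`, phrased elementarily: every short exact sequence
`0 → M → E → M → 0` splits. -/
def RigidModule (A : Type) [Ring A] (M : Type) [AddCommGroup M] [Module A M] : Prop :=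
  ∀ (E : Type) [AddCommGroup E] [Module A E], ∀ (f : M →ₗ[A] E) (g : E →ₗ[A] M),
    Function.Injective f → Function.Surjective g → LinearMap.range f = LinearMap.ker g →
    ∃ s : M →ₗ[A] E, g.comp s = LinearMap.id

/-! ## Corner rings `eAe` and local freeness -/

/-- An idempotent element of a ring. -/
structure IdemElem (A : Type) [Ring A] : Type where
  e : A
  idem : e * e = e

/-- The corner ring `eAe` of an idempotent `e`. -/
def Corner {A : Type} [Ring A] (ε : IdemElem A) : Type :=
  {x : A // ε.e * x = x ∧ x * ε.e = x}

namespace Corner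

variable {A : Type} [Ring A] {ε : IdemElem A}

instance : Zero (Corner ε) := ⟨⟨0, by simp⟩⟩
instance : Add (Corner ε) :=
  ⟨fun x y => ⟨x.1 + y.1, by rw [mul_add, x.2.1, y.2.1], by rw [add_mul, x.2.2, y.2.2]⟩⟩
instance : Neg (Corner ε) :=
  ⟨fun x => ⟨-x.1, by rw [mul_neg, x.2.1], by rw [neg_mul, x.2.2]⟩⟩
instance : One (Corner ε) := ⟨⟨ε.e, ε.idem, ε.idem⟩⟩
instance : Mul (Corner ε) :=
  ⟨fun x y => ⟨x.1 * y.1, by rw [← mul_assoc, x.2.1], by rw [mul_assoc, y.2.2]⟩⟩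

instance instRing : Ring (Corner ε) where
  add_assoc x y z := Subtype.ext (add_assoc _ _ _)
  zero_add x := Subtype.ext (zero_add _)
  add_zero x := Subtype.ext (add_zero _)
  add_comm x y := Subtype.ext (add_comm _ _)
  neg_add_cancel x := Subtype.ext (neg_add_cancel _)
  mul_assoc x y z := Subtype.ext (mul_assoc _ _ _)
  one_mul x := Subtype.ext x.2.1
  mul_one x := Subtype.ext x.2.2
  left_distrib x y z := Subtype.ext (left_distrib _ _ _)
  right_distrib x y z := Subtype.ext (right_distrib _ _ _)
  zero_mul x := Subtype.ext (zero_mul _)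
  mul_zero x := Subtype.ext (mul_zero _)
  nsmul := nsmulRec
  zsmul := zsmulRec

end Corner

/-- The subgroup `eM` of an `A`-module `M`, as a module over the corner ring `eAe`. -/
def CornerMod {A : Type} [Ring A] (ε : IdemElem A) (M : Type) [AddCommGroup M]
    [Module A M] : Type :=
  {m : M // ε.e • m = m}

namespace CornerMod

variable {A : Type} [Ring A] {ε : IdemElem A} {M : Type} [AddCommGroup M] [Module A M]

instance : Zero (CornerMod ε M) := ⟨⟨0, smul_zero _⟩⟩
instance : Add (CornerMod ε M) := ⟨fun x y => ⟨x.1 + y.1, by rw [smul_add, x.2, y.2]⟩⟩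
instance : Neg (CornerMod ε M) := ⟨fun x => ⟨-x.1, by rw [smul_neg, x.2]⟩⟩

instance instAddCommGroup : AddCommGroup (CornerMod ε M) where
  add_assoc x y z := Subtype.ext (add_assoc _ _ _)
  zero_add x := Subtype.ext (zero_add _)
  add_zero x := Subtype.ext (add_zero _)
  add_comm x y := Subtype.ext (add_comm _ _)
  neg_add_cancel x := Subtype.ext (neg_add_cancel _)
  nsmul := nsmulRec
  zsmul := zsmulRec

instance instSMul : SMul (Corner ε) (CornerMod ε M) :=
  ⟨fun c m => ⟨c.1 • m.1, by rw [smul_smul, c.2.1]⟩⟩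

theorem val_smul (c : Corner ε) (m : CornerMod ε M) : (c • m).1 = c.1 • m.1 := rfl
theorem val_zero : (0 : CornerMod ε M).1 = 0 := rfl
theorem val_add (m n : CornerMod ε M) : (m + n).1 = m.1 + n.1 := rfl

instance instModule : Module (Corner ε) (CornerMod ε M) where
  one_smul m := Subtype.ext (by rw [val_smul]; exact m.2)
  mul_smul c d m := Subtype.ext (by simp only [val_smul]; exact mul_smul c.1 d.1 m.1)
  smul_zero c := Subtype.ext (by simp only [val_smul, val_zero]; exact smul_zero c.1)
  smul_add c m n := Subtype.ext
    (by simp only [val_smul, val_add]; exact smul_add c.1 m.1 n.1)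
  add_smul c d m := Subtype.ext
    (by simp only [val_smul, val_add]; exact add_smul c.1 d.1 m.1)
  zero_smul m := Subtype.ext (by simp only [val_smul, val_zero]; exact zero_smul A m.1)

end CornerMod

theorem vertexElem_mul_self (i : Q.V) :
    vertexElem K Q i * vertexElem K Q i = vertexElem K Q i := by
  rw [vertexElem, ← map_mul]
  exact RingQuot.mkAlgHom_rel K (PathRel.idem i)

/-- The idempotent `eᵢ ∈ A = KQ/I` corresponding to a vertex `i`. -/
def vertexIdem {A : Type} [Ring A] [Algebra K A] (φ : PathAlgebra K Q →ₐ[K] A)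
    (i : Q.V) : IdemElem A :=
  ⟨φ (vertexElem K Q i), by rw [← map_mul, vertexElem_mul_self]⟩

/-- An `A = KQ/I`-module `M` is locally free if `eᵢM` is a free `eᵢAeᵢ`-module for
every vertex `i`. -/
def IsLocallyFree {A : Type} [Ring A] [Algebra K A] (φ : PathAlgebra K Q →ₐ[K] A)
    (M : Type) [AddCommGroup M] [Module A M] : Prop :=
  ∀ i : Q.V,
    Module.Free (Corner (vertexIdem K Q φ i)) (CornerMod (vertexIdem K Q φ i) M)

/-! ## Inner derivations and infinitesimal rigidity -/

/-- Every derivation along the algebra homomorphism `ρ` is inner. -/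
def DerivationsInner {A B : Type} [Ring A] [Algebra K A] [Ring B] [Algebra K B]
    (ρ : A →ₐ[K] B) : Prop :=
  ∀ δ : A →ₗ[K] B, (∀ a b, δ (a * b) = δ a * ρ b + ρ a * δ b) →
    ∃ z, ∀ a, δ a = ρ a * z - z * ρ a

variable {K}

/-- Innerness of derivations is invariant under isomorphisms of the target algebra. -/
theorem DerivationsInner.comp_equiv {A B C : Type} [Ring A] [Algebra K A] [Ring B] [Algebra K B]
    [Ring C] [Algebra K C] {ρ : A →ₐ[K] B} (hρ : DerivationsInner K ρ) (f : B ≃ₐ[K] C) :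
    DerivationsInner K (f.toAlgHom.comp ρ) := by
  intro δ hδ
  obtain ⟨z, hz⟩ := hρ (f.symm.toLinearMap ∘ₗ δ) (fun a b => by simp [hδ])
  refine ⟨f z, fun a => ?_⟩
  apply f.symm.injective
  simpa using hz a

/-- The direct sum `M ⊕ M` with the module structure twisted by a derivation `δ`. -/
def TwistedSum {A M : Type} [Ring A] [Algebra K A] [AddCommGroup M] [Module K M]
    (_δ : A →ₗ[K] Module.End K M) : Type := M × M

instance {A M : Type} [Ring A] [Algebra K A] [AddCommGroup M] [Module K M]
    (δ : A →ₗ[K] Module.End K M) : AddCommGroup (TwistedSum δ) :=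
  inferInstanceAs (AddCommGroup (M × M))

/-- The action `a (x, y) = (a x + δ(a) y, a y)`. -/
abbrev TwistedSum.module {A M : Type} [Ring A] [Algebra K A] [AddCommGroup M] [Module K M]
    [Module A M] [IsScalarTower K A M] (δ : A →ₗ[K] Module.End K M)
    (hδ : ∀ a b, δ (a * b) = δ a * Algebra.lsmul K K M b + Algebra.lsmul K K M a * δ b) :
    Module A (TwistedSum δ) where
  smul a x := ((a • x.1 + δ a x.2, a • x.2) : M × M)
  one_smul x := by
    have h1 : δ 1 = 0 := by simpa using hδ 1 1
    refine Prod.ext ?_ ?_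
    · change (1 : A) • x.1 + δ 1 x.2 = x.1
      simp [h1]
    · exact one_smul A x.2
  mul_smul a b x := by
    refine Prod.ext ?_ ?_
    · change (a * b) • x.1 + δ (a * b) x.2 = a • (b • x.1 + δ b x.2) + δ a (b • x.2)
      simp only [hδ, mul_smul, smul_add, LinearMap.add_apply, Module.End.mul_apply,
        Algebra.lsmul_coe]
      abel
    · exact mul_smul a b x.2
  smul_zero a := by
    refine Prod.ext ?_ ?_
    · change a • (0 : M) + δ a (0 : M) = 0
      simp
    · exact smul_zero a
  smul_add a x y := by
    refine Prod.ext ?_ ?_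
    · change a • (x.1 + y.1) + δ a (x.2 + y.2) = (a • x.1 + δ a x.2) + (a • y.1 + δ a y.2)
      simp only [smul_add, map_add]
      abel
    · exact smul_add a x.2 y.2
  add_smul a b x := by
    refine Prod.ext ?_ ?_
    · change (a + b) • x.1 + δ (a + b) x.2 = (a • x.1 + δ a x.2) + (b • x.1 + δ b x.2)
      simp only [add_smul, map_add, LinearMap.add_apply]
      abel
    · exact add_smul a b x.2
  zero_smul x := by
    refine Prod.ext ?_ ?_
    · change (0 : A) • x.1 + δ 0 x.2 = 0
      simp
    · exact zero_smul A x.2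

/-- Derivations with values in the endomorphisms of a rigid module are inner. -/
theorem RigidModule.derivationsInner {A M : Type} [Ring A] [Algebra K A] [AddCommGroup M]
    [Module K M] [Module A M] [IsScalarTower K A M] (hM : RigidModule A M) :
    DerivationsInner K (Algebra.lsmul K K M : A →ₐ[K] Module.End K M) := by
  intro δ hδ
  let _ := TwistedSum.module δ hδ
  let f : M →ₗ[A] TwistedSum δ :=
    { toFun := fun x => ((x, 0) : M × M)
      map_add' := fun x y => Prod.ext rfl (add_zero (0 : M)).symm
      map_smul' := fun a x => Prod.ext
        (by change a • x = a • x + δ a 0; simp) (smul_zero a).symm }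
  let g : TwistedSum δ →ₗ[A] M :=
    { toFun := fun x => x.2
      map_add' := fun x y => rfl
      map_smul' := fun a x => rfl }
  obtain ⟨s, hs⟩ := hM (TwistedSum δ) f g (fun x y h => congrArg Prod.fst h)
    (fun y => ⟨((0, y) : M × M), rfl⟩) (by
      ext x
      constructor
      · rintro ⟨y, rfl⟩
        rfl
      · intro hx
        exact ⟨x.1, Prod.ext rfl (Eq.symm hx)⟩)
  have hs2 : ∀ y, (s y).2 = y := fun y => LinearMap.congr_fun hs y
  have hsmul : ∀ (a : A) y, (s (a • y)).1 = a • (s y).1 + δ a y := fun a y => by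
    rw [map_smul]
    change a • (s y).1 + δ a (s y).2 = _
    rw [hs2]
  have h_alg : ∀ c : K, δ (algebraMap K A c) = 0 := fun c => by
    have h1 : δ 1 = 0 := by simpa using hδ 1 1
    rw [Algebra.algebraMap_eq_smul_one, map_smul, h1, smul_zero]
  let z : M →ₗ[K] M :=
    { toFun := fun y => (s y).1
      map_add' := fun x y => by rw [map_add]; rfl
      map_smul' := fun c y => by
        have := hsmul (algebraMap K A c) y
        rw [h_alg] at this
        simpa using this }
  refine ⟨-z, fun a => LinearMap.ext fun y => ?_⟩
  have := hsmul a y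
  change δ a y = a • (-(s y).1) - -(s (a • y)).1
  rw [this]
  simp

/-- Innerness of derivations passes to finite powers of a representation. -/
theorem DerivationsInner.pi {A M : Type} [Ring A] [Algebra K A] [AddCommGroup M]
    [Module K M] [Module A M] [IsScalarTower K A M] {κ : Type} [Fintype κ] [DecidableEq κ]
    (h : DerivationsInner K (Algebra.lsmul K K M : A →ₐ[K] Module.End K M)) :
    DerivationsInner K (Algebra.lsmul K K (κ → M) : A →ₐ[K] Module.End K (κ → M)) := by
  intro δ hδ
  have key : ∀ p q : κ, ∃ z : Module.End K M, ∀ a x,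
      δ a (Pi.single q x) p = a • z x - z (a • x) := by
    intro p q
    let δ' : A →ₗ[K] Module.End K M :=
      { toFun := fun a => LinearMap.proj p ∘ₗ δ a ∘ₗ LinearMap.single K (fun _ => M) q
        map_add' := fun a b => by ext; simp
        map_smul' := fun a b => by ext; simp }
    obtain ⟨z, hz⟩ := h δ' (fun a b => by
      ext x
      simp [δ', hδ, Pi.single_smul])
    refine ⟨z, fun a x => ?_⟩
    simpa [δ'] using LinearMap.congr_fun (hz a) x
  choose z hz using key
  refine ⟨LinearMap.pi fun p => ∑ q, z p q ∘ₗ LinearMap.proj q, fun a => ?_⟩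
  refine LinearMap.ext fun x => funext fun p => ?_
  have hx : x = ∑ q, Pi.single q (x q) := (Finset.univ_sum_single x).symm
  conv_lhs => rw [hx, map_sum, Finset.sum_apply]
  simp [hz, Finset.smul_sum]

/-! ## Deformations of representations with inner derivations -/

/-- A partial inverse of a linear map between vector spaces. -/
theorem exists_linearMap_section {V W : Type} [AddCommGroup V] [Module K V] [AddCommGroup W]
    [Module K W] (f : V →ₗ[K] W) : ∃ h : W →ₗ[K] V, ∀ v, f (h (f v)) = f v := by
  obtain ⟨g, hg⟩ := f.rangeRestrict.exists_rightInverse_of_surjective f.range_rangeRestrict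
  obtain ⟨h, hh⟩ := LinearMap.exists_extend g
  refine ⟨h, fun v => ?_⟩
  have h1 : h (f v) = g (f.rangeRestrict v) := by rw [← hh]; rfl
  rw [h1]
  exact congrArg Subtype.val (LinearMap.congr_fun hg (f.rangeRestrict v))

/-- A linear map out of `Hom(A, Mat(K))` extends to all coefficient rings, compatibly with
linear functionals. -/
theorem exists_coefficient_extension {A D : Type} [AddCommGroup A] [Module K A]
    [Module.Finite K A] [Fintype D] [DecidableEq D]
    (h : (A →ₗ[K] Matrix D D K) →ₗ[K] Matrix D D K)
    {R : Type} [CommRing R] [Algebra K R] (T : A →ₗ[K] Matrix D D R) :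
    ∃ Z : Matrix D D R,
      (∀ I : Ideal R, (∀ a u v, T a u v ∈ I) → ∀ u v, Z u v ∈ I) ∧
      ∀ l : R →ₗ[K] K, Z.map l = h (l.mapMatrix ∘ₗ T) := by
  let b := Module.finBasis K A
  let E : Fin (Module.finrank K A) → D → D → (A →ₗ[K] Matrix D D K) := fun k u v =>
    b.constr K (Pi.single k (Matrix.single u v 1))
  have hδ : ∀ δ : A →ₗ[K] Matrix D D K, δ = ∑ k, ∑ u, ∑ v, δ (b k) u v • E k u v := by
    intro δ
    refine b.ext fun j => ?_
    have hE : ∀ k u v, E k u v (b j) = if k = j then Matrix.single u v (1 : K) else 0 := by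
      intro k u v
      simp only [E, Module.Basis.constr_basis, Pi.single_apply, eq_comm]
    simp only [LinearMap.sum_apply, LinearMap.smul_apply, hE, smul_ite, smul_zero]
    conv_lhs => rw [Matrix.matrix_eq_sum_single (δ (b j))]
    rw [Finset.sum_eq_single j]
    · simp
    · intro k _ hk
      simp [hk]
    · simp
  refine ⟨∑ k, ∑ u, ∑ v, T (b k) u v • (h (E k u v)).map (algebraMap K R), ?_, ?_⟩
  · intro I hI u v
    simp only [Matrix.sum_apply, Matrix.smul_apply, smul_eq_mul]
    exact I.sum_mem fun k _ => I.sum_mem fun p _ => I.sum_mem fun q _ =>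
      I.mul_mem_right _ (hI _ _ _)
  · intro l
    rw [hδ (l.mapMatrix ∘ₗ T)]
    ext u v
    simp only [map_sum, map_smul, Matrix.sum_apply, Matrix.smul_apply, Matrix.map_apply,
      smul_eq_mul, LinearMap.comp_apply, LinearMap.mapMatrix_apply]
    refine Finset.sum_congr rfl fun k _ => Finset.sum_congr rfl fun p _ =>
      Finset.sum_congr rfl fun q _ => ?_
    rw [mul_comm, ← Algebra.smul_def, map_smul, smul_eq_mul, mul_comm]

/-- A deformation of a representation all of whose derivations are inner is infinitesimally
trivial to any order. -/
theorem exists_conj_mod_pow {A D : Type} [Ring A] [Algebra K A] [Module.Finite K A] [Fintype D]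
    [DecidableEq D] {ρ : A →ₐ[K] Matrix D D K} (hρ : DerivationsInner K ρ)
    {R : Type} [CommRing R] [Algebra K R] (ε : R →ₐ[K] K) (Φ : A →ₐ[K] Matrix D D R)
    (hΦ : ∀ a, (Φ a).map ε = ρ a) (n : ℕ) :
    ∃ P : Matrix D D R, P.map ε = 1 ∧
      ∀ a u v, (P * Φ a - (ρ a).map (algebraMap K R) * P) u v ∈ RingHom.ker ε ^ (n + 1) := by
  have hΦm : ∀ a u v, (Φ a - (ρ a).map (algebraMap K R)) u v ∈ RingHom.ker ε := by
    intro a u v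
    have := congrFun (congrFun (hΦ a) u) v
    simp only [Matrix.map_apply] at this
    simp [RingHom.mem_ker, this]
  induction n with
  | zero =>
    refine ⟨1, ?_, fun a u v => ?_⟩
    · exact Matrix.map_one _ (map_zero _) (map_one _)
    · simpa using hΦm a u v
  | succ n ih =>
    obtain ⟨P, hP, hPm⟩ := ih
    let T : A →ₗ[K] Matrix D D R :=
      { toFun := fun a => P * Φ a - (ρ a).map (algebraMap K R) * P
        map_add' := fun a b => by
          rw [map_add, map_add, Matrix.map_add _ (map_add _), mul_add, add_mul]
          abel
        map_smul' := fun c a => by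
          have : (c • ρ a).map (algebraMap K R) = c • (ρ a).map (algebraMap K R) := by
            ext u v
            rw [Matrix.map_apply, Matrix.smul_apply, Matrix.smul_apply, Matrix.map_apply,
              smul_eq_mul, map_mul, Algebra.smul_def]
          rw [map_smul, map_smul, this, Matrix.mul_smul, Matrix.smul_mul, RingHom.id_apply,
            smul_sub] }
    have hT : ∀ a, T a = P * Φ a - (ρ a).map (algebraMap K R) * P := fun a => rfl
    let inn : Matrix D D K →ₗ[K] (A →ₗ[K] Matrix D D K) :=
      { toFun := fun z =>
          { toFun := fun a => ρ a * z - z * ρ a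
            map_add' := fun a b => by rw [map_add, add_mul, mul_add]; abel
            map_smul' := fun c a => by simp [smul_sub] }
        map_add' := fun y z => by
          ext1 a
          change ρ a * (y + z) - (y + z) * ρ a = (ρ a * y - y * ρ a) + (ρ a * z - z * ρ a)
          rw [add_mul, mul_add]; abel
        map_smul' := fun c z => by
          ext1 a
          change ρ a * (c • z) - (c • z) * ρ a = c • (ρ a * z - z * ρ a)
          simp [smul_sub] }
    obtain ⟨h, hh⟩ := exists_linearMap_section inn
    obtain ⟨Z, hZI, hZ⟩ := exists_coefficient_extension h T
    have hZm : ∀ u v, Z u v ∈ RingHom.ker ε ^ (n + 1) := hZI _ hPm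
    refine ⟨P + Z, ?_, fun a u v => ?_⟩
    · rw [Matrix.map_add _ (map_add ε), hP]
      have : Z.map ε = 0 := by
        ext u v
        exact (RingHom.mem_ker).1 (Ideal.pow_le_self (Nat.succ_ne_zero n) (hZm u v))
      rw [this, add_zero]
    · have hmul : ∀ (X : Matrix D D R), (∀ u v, X u v ∈ RingHom.ker ε ^ (n + 1)) →
          ∀ a u v, (X * (Φ a - (ρ a).map (algebraMap K R))) u v ∈ RingHom.ker ε ^ (n + 2) := by
        intro X hX a u v
        rw [Matrix.mul_apply, pow_succ _ (n + 1)]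
        exact Ideal.sum_mem _ fun k _ => Ideal.mul_mem_mul (hX _ _) (hΦm _ _ _)
      by_contra hnot
      obtain ⟨l, hl, hlker⟩ := Submodule.exists_le_ker_of_notMem
        (p := (RingHom.ker ε ^ (n + 2)).restrictScalars K) hnot
      have hl0 : ∀ X : Matrix D D R, (∀ u v, X u v ∈ RingHom.ker ε ^ (n + 2)) → X.map l = 0 := by
        intro X hX
        ext p q
        exact hlker (hX p q)
      have hL : ∀ (X : Matrix D D K) (Y : Matrix D D R),
          (X.map (algebraMap K R) * Y).map l = X * Y.map l := by
        intro X Y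
        ext p q
        simp [Matrix.mul_apply, ← Algebra.smul_def]
      have hR : ∀ (X : Matrix D D K) (Y : Matrix D D R),
          (Y * X.map (algebraMap K R)).map l = Y.map l * X := by
        intro X Y
        ext p q
        simp only [Matrix.mul_apply, Matrix.map_apply, map_sum]
        refine Finset.sum_congr rfl fun k _ => ?_
        rw [mul_comm, ← Algebra.smul_def, map_smul, smul_eq_mul, mul_comm]
      have hsplit : ∀ (X : Matrix D D R), (∀ u v, X u v ∈ RingHom.ker ε ^ (n + 1)) →
          ∀ a, (X * Φ a).map l = X.map l * ρ a := by
        intro X hX a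
        have h1 : X * Φ a = X * (Φ a - (ρ a).map (algebraMap K R))
            + X * (ρ a).map (algebraMap K R) := by rw [mul_sub]; abel
        rw [h1, Matrix.map_add _ (map_add l), hl0 _ (hmul X hX a), zero_add, hR]
      obtain ⟨z, hz⟩ := hρ (l.mapMatrix ∘ₗ T) (fun a b => by
        have h1 : T (a * b) = T a * Φ b + (ρ a).map (algebraMap K R) * T b := by
          rw [hT, hT, hT, map_mul, map_mul, Matrix.map_mul]
          noncomm_ring
        simp only [LinearMap.comp_apply, LinearMap.mapMatrix_apply]
        rw [h1, Matrix.map_add _ (map_add l), hsplit (T a) (hPm a), hL])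
      have hin : inn z = l.mapMatrix ∘ₗ T := LinearMap.ext fun a => (hz a).symm
      have hfin := hh z
      rw [hin, ← hZ l] at hfin
      have hfin' : ρ a * Z.map l - Z.map l * ρ a = (T a).map l := LinearMap.congr_fun hfin a
      refine hl ?_
      have h2 : (P + Z) * Φ a - (ρ a).map (algebraMap K R) * (P + Z)
          = T a + (Z * Φ a - (ρ a).map (algebraMap K R) * Z) := by
        rw [hT]; noncomm_ring
      have h3 : ((P + Z) * Φ a - (ρ a).map (algebraMap K R) * (P + Z)).map l = 0 := by
        rw [h2, Matrix.map_add _ (map_add l), Matrix.map_sub _ (map_sub l), hsplit Z hZm, hL,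
          ← hfin']
        abel
      exact congrFun (congrFun h3 u) v

/-- If a generic deformation of a representation with inner derivations has a determinant
condition satisfied, so does the representation itself. -/
theorem exists_det_ne_zero_of_deformation [Infinite K] {A D Λ : Type} [Ring A] [Algebra K A]
    [Module.Finite K A] [Fintype D] [DecidableEq D] {ρ : A →ₐ[K] Matrix D D K}
    (hρ : DerivationsInner K ρ) {R : Type} [CommRing R] [IsDomain R] [IsNoetherianRing R]
    [Algebra K R] (ε : R →ₐ[K] K) (Φ : A →ₐ[K] Matrix D D R)
    (hΦ : ∀ a, (Φ a).map ε = ρ a) (β : D → A) (σ : D → Λ) (v : Λ → D → R)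
    (hv : (Matrix.of fun u s => (Φ (β s)).mulVec (v (σ s)) u).det ≠ 0) :
    ∃ w : Λ → D → K, (Matrix.of fun u s => (ρ (β s)).mulVec (w (σ s)) u).det ≠ 0 := by
  by_contra! hw
  have hwR : ∀ w : Λ → D → R, (Matrix.of fun u s =>
      ((ρ (β s)).map (algebraMap K R)).mulVec (w (σ s)) u).det = 0 := by
    let p : MvPolynomial (Λ × D) K := (Matrix.of fun u s =>
      ∑ j, MvPolynomial.C (ρ (β s) u j) * MvPolynomial.X (σ s, j)).det
    have hp : p = 0 := by
      refine MvPolynomial.funext fun x => ?_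
      rw [map_zero, ← hw fun k j => x (k, j), RingHom.map_det]
      congr 1
      ext u s
      simp [Matrix.mulVec, dotProduct]
    intro w
    have := congrArg (MvPolynomial.aeval fun x : Λ × D => w x.1 x.2) hp
    rw [map_zero, AlgHom.map_det] at this
    rw [← this]
    congr 1
    ext u s
    simp [Matrix.mulVec, dotProduct]
  have hmem : ∀ n, (Matrix.of fun u s => (Φ (β s)).mulVec (v (σ s)) u).det
      ∈ RingHom.ker ε ^ n := by
    intro n
    obtain ⟨P, hP, hPm⟩ := exists_conj_mod_pow hρ ε Φ hΦ n
    refine Ideal.pow_le_pow_right (Nat.le_succ n) ?_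
    let π := Ideal.Quotient.mk (RingHom.ker ε ^ (n + 1))
    have h1 : π (P.det * (Matrix.of fun u s => (Φ (β s)).mulVec (v (σ s)) u).det) = 0 := by
      rw [← Matrix.det_mul, ← map_zero π, ← hwR fun k => P.mulVec (v k), RingHom.map_det,
        RingHom.map_det]
      congr 1
      ext u s
      simp only [RingHom.mapMatrix_apply, Matrix.map_apply, Matrix.of_apply]
      refine Ideal.Quotient.eq.2 ?_
      have h2 : (P * Matrix.of fun u s => (Φ (β s)).mulVec (v (σ s)) u) u s
          = (P * Φ (β s)).mulVec (v (σ s)) u := by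
        rw [← Matrix.mulVec_mulVec]
        rfl
      rw [h2, Matrix.mulVec_mulVec, ← Pi.sub_apply, ← Matrix.sub_mulVec]
      exact Ideal.sum_mem _ fun k _ => Ideal.mul_mem_right _ _ (hPm _ _ _)
    have h3 : IsUnit (π P.det) := by
      have h4 : 1 - P.det ∈ RingHom.ker ε := by
        have h5 : ε P.det = 1 := by
          rw [AlgHom.map_det]
          have : ε.mapMatrix P = P.map ε := rfl
          rw [this, hP, Matrix.det_one]
        simp [RingHom.mem_ker, h5]
      have h6 : IsNilpotent (π (1 - P.det)) := by
        refine ⟨n + 1, ?_⟩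
        rw [← map_pow]
        exact Ideal.Quotient.eq_zero_iff_mem.2 (Ideal.pow_mem_pow h4 _)
      simpa using h6.isUnit_one_sub
    rw [map_mul, h3.mul_right_eq_zero] at h1
    exact Ideal.Quotient.eq_zero_iff_mem.1 h1
  have hbot := Ideal.iInf_pow_eq_bot_of_isDomain (RingHom.ker ε) (RingHom.ker_ne_top ε)
  refine hv ?_
  have : _ ∈ ⨅ i : ℕ, RingHom.ker ε ^ i := (Submodule.mem_iInf _).2 hmem
  rw [hbot] at this
  exact this
/-! ## Homomorphisms out of an algebra presented by a quiver -/

section Presentation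

variable {Q}

/-- Elements `E j` and `X a` of an algebra that satisfy the defining relations of the path
algebra. -/
structure IsPathFamily {B : Type} [Ring B] (E : Q.V → B) (X : Q.A → B) : Prop where
  idem : ∀ i, E i * E i = E i
  orth : ∀ i j, i ≠ j → E i * E j = 0
  sum_one : ∑ i, E i = 1
  tgt_mul : ∀ a, E (Q.tgt a) * X a = X a
  mul_src : ∀ a, X a * E (Q.src a) = X a

variable {A B : Type} [Ring A] [Algebra K A] [Ring B] [Algebra K B]
  {φ : PathAlgebra K Q →ₐ[K] A}

theorem isPathFamily_map (φ : PathAlgebra K Q →ₐ[K] A) :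
    IsPathFamily (fun i => φ (vertexElem K Q i)) (fun a => φ (arrowElem K Q a)) where
  idem i := by rw [← map_mul, vertexElem_mul_self]
  orth i j h := by
    rw [← map_mul, vertexElem, vertexElem, ← map_mul,
      RingQuot.mkAlgHom_rel K (PathRel.orth i j h), map_zero, map_zero]
  sum_one := by
    have : ∑ i, vertexElem K Q i = 1 := by
      simp only [vertexElem]
      rw [← map_sum, RingQuot.mkAlgHom_rel K PathRel.sum_one, map_one]
    rw [← map_sum, this, map_one]
  tgt_mul a := by
    rw [← map_mul, vertexElem, arrowElem, ← map_mul, RingQuot.mkAlgHom_rel K (PathRel.tgt_mul a)]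
  mul_src a := by
    rw [← map_mul, vertexElem, arrowElem, ← map_mul, RingQuot.mkAlgHom_rel K (PathRel.mul_src a)]

theorem IsPathFamily.arrow_mul_eq_zero {E : Q.V → B} {X : Q.A → B} (h : IsPathFamily E X)
    {a b : Q.A} (hab : Q.src a ≠ Q.tgt b) : X a * X b = 0 := by
  rw [← h.mul_src a, ← h.tgt_mul b, mul_assoc, ← mul_assoc (E _), h.orth _ _ hab]
  simp

theorem IsPathFamily.vertex_mul_arrow {E : Q.V → B} {X : Q.A → B} (h : IsPathFamily E X)
    (j : Q.V) (a : Q.A) : E j * X a = if j = Q.tgt a then X a else 0 := by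
  split_ifs with hj
  · rw [hj, h.tgt_mul]
  · rw [← h.tgt_mul a, ← mul_assoc, h.orth _ _ hj, zero_mul]

theorem IsPathFamily.arrow_mul_vertex {E : Q.V → B} {X : Q.A → B} (h : IsPathFamily E X)
    (j : Q.V) (a : Q.A) : X a * E j = if j = Q.src a then X a else 0 := by
  split_ifs with hj
  · rw [hj, h.mul_src]
  · rw [← h.mul_src a, mul_assoc, h.orth _ _ (Ne.symm hj), mul_zero]

theorem IsPathFamily.prod_eq_zero_of_not_isChain {E : Q.V → B} {X : Q.A → B}
    (h : IsPathFamily E X) (L : List Q.A)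
    (hL : ¬ L.IsChain fun a b => Q.src a = Q.tgt b) : (L.map X).prod = 0 := by
  induction L with
  | nil => exact absurd List.IsChain.nil hL
  | cons a L ih =>
    cases L with
    | nil => exact absurd (List.IsChain.singleton a) hL
    | cons b L =>
      rw [List.isChain_cons_cons, not_and_or] at hL
      rcases hL with hL | hL
      · rw [List.map_cons, List.map_cons, List.prod_cons, List.prod_cons, ← mul_assoc,
          h.arrow_mul_eq_zero hL, zero_mul]
      · rw [List.map_cons, List.prod_cons, ih hL, mul_zero]

/-- A subalgebra containing the images of all vertices and arrows is everything. -/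
theorem mem_subalgebra_of_generators (hφ : Function.Surjective φ) (S : Subalgebra K A)
    (hv : ∀ i, φ (vertexElem K Q i) ∈ S) (ha : ∀ a, φ (arrowElem K Q a) ∈ S) (x : A) :
    x ∈ S := by
  obtain ⟨y, rfl⟩ := hφ x
  obtain ⟨z, rfl⟩ := RingQuot.mkAlgHom_surjective K (PathRel K Q) y
  induction z with
  | grade0 r => simpa only [AlgHom.commutes] using S.algebraMap_mem r
  | grade1 x =>
    cases x with
    | inl i => exact hv i
    | inr a => exact ha a
  | mul a b iha ihb => simpa only [map_mul] using S.mul_mem iha ihb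
  | add a b iha ihb => simpa only [map_add] using S.add_mem iha ihb

/-- Homomorphisms agreeing on vertices and arrows are equal. -/
theorem algHom_ext_of_generators (hφ : Function.Surjective φ) {f g : A →ₐ[K] B}
    (hv : ∀ i, f (φ (vertexElem K Q i)) = g (φ (vertexElem K Q i)))
    (ha : ∀ a, f (φ (arrowElem K Q a)) = g (φ (arrowElem K Q a))) : f = g :=
  AlgHom.ext fun x => mem_subalgebra_of_generators hφ (AlgHom.equalizer f g) hv ha x

/-- The value of a linear combination of paths on a family of arrow elements. -/
theorem map_relElem (f : PathAlgebra K Q →ₐ[K] B) (c : QPath Q →₀ K) :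
    f (relElem K Q c) =
      c.sum fun p l => l • (p.arrows.map fun a => f (arrowElem K Q a)).prod := by
  rw [relElem, map_finsuppSum]
  refine Finsupp.sum_congr fun p _ => ?_
  rw [map_smul, pathElem, map_list_prod, List.map_map]
  rfl

/-- The universal property of an algebra given by an admissible presentation. -/
theorem exists_algHom_of_relations (hadm : IsAdmissiblePresentation K Q φ) {E : Q.V → B}
    {X : Q.A → B} (h : IsPathFamily E X)
    (hrel : ∀ (c : QPath Q →₀ K) (i j : Q.V), IsRelationData K Q c i j →
      φ (relElem K Q c) = 0 → (c.sum fun p l => l • (p.arrows.map X).prod) = 0) :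
    ∃ Ψ : A →ₐ[K] B, (∀ i, Ψ (φ (vertexElem K Q i)) = E i) ∧
      ∀ a, Ψ (φ (arrowElem K Q a)) = X a := by
  obtain ⟨hφ, ⟨S, hS, hker⟩, -⟩ := hadm
  let F : PathAlgebra K Q →ₐ[K] B := RingQuot.liftAlgHom K
    ⟨FreeAlgebra.lift K (Sum.elim E X), by
      intro x y hxy
      cases hxy with
      | idem i => simpa using h.idem i
      | orth i j hij => simpa using h.orth i j hij
      | sum_one => simpa using h.sum_one
      | tgt_mul a => simpa using h.tgt_mul a
      | mul_src a => simpa using h.mul_src a⟩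
  have hFv : ∀ i, F (vertexElem K Q i) = E i := fun i => by
    simp [F, vertexElem, RingQuot.liftAlgHom_mkAlgHom_apply]
  have hFa : ∀ a, F (arrowElem K Q a) = X a := fun a => by
    simp [F, arrowElem, RingQuot.liftAlgHom_mkAlgHom_apply]
  have hSφ : ∀ s ∈ S, φ s = 0 := by
    intro s hs
    have : s ∈ twoSidedSpan (PathAlgebra K Q) S :=
      AddSubgroup.subset_closure ⟨1, 1, s, hs, by simp⟩
    rw [hker] at this
    exact this
  have hFS : ∀ s ∈ S, F s = 0 := by
    intro s hs
    obtain ⟨c, i, j, hc, rfl⟩ := hS s hs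
    rw [map_relElem]
    simp only [hFa]
    exact hrel c i j hc (hSφ _ hs)
  have hF : ∀ x, φ x = 0 → F x = 0 := by
    intro x hx
    have hx' : x ∈ twoSidedSpan (PathAlgebra K Q) S := by
      rw [hker]
      exact hx
    change x ∈ AddSubgroup.closure _ at hx'
    clear hx
    induction hx' using AddSubgroup.closure_induction with
    | mem x hx =>
      obtain ⟨a, b, s, hs, rfl⟩ := hx
      rw [map_mul, map_mul, hFS s hs, mul_zero, zero_mul]
    | zero => exact map_zero F
    | add x y hx hy ihx ihy => rw [map_add, ihx, ihy, add_zero]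
    | neg x hx ihx => rw [map_neg, ihx, neg_zero]
  have hF' : ∀ x y, φ x = φ y → F x = F y := fun x y hxy => by
    rw [← sub_eq_zero, ← map_sub]
    exact hF _ (by rw [map_sub, hxy, sub_self])
  have hsurj := Function.surjInv_eq hφ
  let Ψ : A →ₐ[K] B := AlgHom.ofLinearMap
    { toFun := fun a => F (Function.surjInv hφ a)
      map_add' := fun x y => by
        rw [← map_add]
        exact hF' _ _ (by rw [map_add, hsurj, hsurj, hsurj])
      map_smul' := fun r x => by
        rw [RingHom.id_apply, ← map_smul]
        exact hF' _ _ (by rw [map_smul, hsurj, hsurj]) }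
    (by
      rw [← map_one F]
      exact hF' _ _ (by rw [hsurj, map_one]))
    (fun x y => by
      change F _ = F _ * F _
      rw [← map_mul]
      exact hF' _ _ (by rw [map_mul, hsurj, hsurj, hsurj]))
  have hΨ : ∀ x, Ψ (φ x) = F x := fun x => hF' _ _ (hsurj _)
  exact ⟨Ψ, fun i => by rw [hΨ, hFv], fun a => by rw [hΨ, hFa]⟩

/-- The one-dimensional representation at a vertex. -/
theorem exists_character (hadm : IsAdmissiblePresentation K Q φ) (i : Q.V) :
    ∃ χ : A →ₐ[K] K, ∀ j, χ (φ (vertexElem K Q j)) = if j = i then 1 else 0 := by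
  obtain ⟨χ, hχ, -⟩ := exists_algHom_of_relations (B := K) (E := fun j => if j = i then 1 else 0)
    (X := fun _ => 0) hadm
    { idem := fun j => by simp
      orth := fun j k h => by
        by_cases hj : j = i
        · subst hj
          simp [Ne.symm h]
        · simp [hj]
      sum_one := by simp
      tgt_mul := fun a => by simp
      mul_src := fun a => by simp }
    (fun c _ _ _ _ => Finset.sum_eq_zero fun p _ => by
      simp [p.ne])
  exact ⟨χ, hχ⟩

/-! ## The radical -/

/-- An admissibly presented algebra is the sum of the span of its vertices and a nilpotent
two-sided ideal. -/
theorem exists_radical (hadm : IsAdmissiblePresentation K Q φ) :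
    ∃ H : Submodule K A, (⊤ : Submodule K A) * H ≤ H ∧ H * ⊤ ≤ H ∧ (∃ m : ℕ, H ^ m = ⊥) ∧
      Submodule.span K (Set.range fun i => φ (vertexElem K Q i)) ⊔ H = ⊤ := by
  have hf := isPathFamily_map φ
  set e : Q.V → A := fun i => φ (vertexElem K Q i)
  set x : Q.A → A := fun a => φ (arrowElem K Q a)
  set T := Submodule.span K (Set.range e)
  set G := Submodule.span K (Set.range x)
  have hTT : T * T ≤ T := by
    rw [Submodule.span_mul_span, Submodule.span_le]
    rintro _ ⟨_, ⟨i, rfl⟩, _, ⟨j, rfl⟩, rfl⟩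
    by_cases hij : i = j
    · subst hij
      have := hf.idem i
      simp only at this ⊢
      rw [this]
      exact Submodule.subset_span ⟨i, rfl⟩
    · have := hf.orth i j hij
      simp only at this ⊢
      rw [this]
      exact Submodule.zero_mem _
  have hGT : G * T ≤ G := by
    rw [Submodule.span_mul_span, Submodule.span_le]
    rintro _ ⟨_, ⟨a, rfl⟩, _, ⟨i, rfl⟩, rfl⟩
    have := hf.arrow_mul_vertex i a
    simp only at this ⊢
    rw [this]
    split_ifs
    · exact Submodule.subset_span ⟨a, rfl⟩
    · exact Submodule.zero_mem _
  obtain ⟨hφ, -, m, hm, hpath⟩ := hadm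
  have hGm : G ^ m = ⊥ := by
    rw [Submodule.span_pow, Submodule.span_eq_bot]
    intro y hy
    obtain ⟨f, rfl⟩ := Set.mem_pow.1 hy
    choose a ha using fun k => (f k).2
    have hL : List.ofFn (fun k => (f k : A)) = (List.ofFn a).map x := by
      rw [List.map_ofFn]
      congr 1
      exact funext fun k => (ha k).symm
    rw [hL]
    by_cases hc : (List.ofFn a).IsChain fun a b => Q.src a = Q.tgt b
    · have hlen : (List.ofFn a).length = m := List.length_ofFn
      have := hpath ⟨List.ofFn a, fun h => by rw [h] at hlen; simp at hlen; omega, hc⟩ hlen.ge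
      rw [pathElem, map_list_prod, List.map_map] at this
      exact this
    · exact hf.prod_eq_zero_of_not_isChain _ hc
  have htop : (⊤ : Submodule K A) * ⊤ = ⊤ :=
    Submodule.eq_top_iff'.2 fun y => one_mul y ▸ Submodule.mul_mem_mul Submodule.mem_top
      Submodule.mem_top
  have hle : G ≤ ⊤ * G := fun y hy =>
    one_mul y ▸ Submodule.mul_mem_mul Submodule.mem_top hy
  have hGtop : G * ⊤ ≤ ⊤ * G := by
    let S : Subalgebra K A :=
      { carrier := {y | ∀ g ∈ G, g * y ∈ (⊤ : Submodule K A) * G}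
        mul_mem' := by
          intro y z hy hz g hg
          rw [← mul_assoc]
          refine Submodule.mul_induction_on (hy g hg) (fun p hp q hq => ?_) fun p q hp hq => ?_
          · rw [mul_assoc, ← htop, mul_assoc]
            exact Submodule.mul_mem_mul hp (hz q hq)
          · rw [add_mul]
            exact Submodule.add_mem _ hp hq
        add_mem' := by
          intro y z hy hz g hg
          rw [mul_add]
          exact Submodule.add_mem _ (hy g hg) (hz g hg)
        algebraMap_mem' := by
          intro r g hg
          rw [← Algebra.commutes]
          exact Submodule.mul_mem_mul Submodule.mem_top hg }
    refine Submodule.mul_le.2 fun g hg y _ => mem_subalgebra_of_generators hφ S ?_ ?_ y g hg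
    · intro i g hg
      exact hle (hGT (Submodule.mul_mem_mul hg (Submodule.subset_span ⟨i, rfl⟩)))
    · intro a g hg
      exact Submodule.mul_mem_mul Submodule.mem_top (Submodule.subset_span ⟨a, rfl⟩)
  have htopH : ⊤ * (⊤ * G) ≤ ⊤ * G := by rw [← mul_assoc, htop]
  have hHtop : ⊤ * G * ⊤ ≤ ⊤ * G := by
    rw [mul_assoc]
    exact (Submodule.smul_mono le_rfl hGtop).trans htopH
  refine ⟨⊤ * G, htopH, hHtop, ⟨m, ?_⟩, ?_⟩
  · have hpow : ∀ k, (⊤ * G) ^ (k + 1) ≤ ⊤ * G ^ (k + 1) := by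
      intro k
      induction k with
      | zero => rw [zero_add, pow_one, pow_one]
      | succ k ih =>
        calc (⊤ * G) ^ (k + 1 + 1) = (⊤ * G) * (⊤ * G) ^ (k + 1) := pow_succ' _ _
          _ ≤ (⊤ * G) * (⊤ * G ^ (k + 1)) := Submodule.smul_mono le_rfl ih
          _ = ⊤ * G * ⊤ * G ^ (k + 1) := (mul_assoc _ _ _).symm
          _ ≤ ⊤ * G * G ^ (k + 1) := Submodule.smul_mono_left hHtop
          _ = ⊤ * G ^ (k + 1 + 1) := by rw [mul_assoc, ← pow_succ']
    obtain ⟨k, rfl⟩ : ∃ k, m = k + 1 := ⟨m - 1, by omega⟩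
    exact le_bot_iff.1 ((hpow k).trans (by rw [hGm, Submodule.mul_bot]))
  · let S : Subalgebra K A :=
      { carrier := {y | y ∈ T ⊔ ⊤ * G}
        mul_mem' := by
          intro y z hy hz
          have h : y * z ∈ (T ⊔ ⊤ * G) * (T ⊔ ⊤ * G) := Submodule.mul_mem_mul hy hz
          rw [Submodule.sup_mul, Submodule.mul_sup] at h
          refine sup_le (sup_le (hTT.trans le_sup_left) ?_) ?_ h
          · exact ((Submodule.smul_mono_left le_top).trans htopH).trans le_sup_right
          · exact ((Submodule.smul_mono le_rfl le_top).trans hHtop).trans le_sup_right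
        add_mem' := fun hy hz => Submodule.add_mem (T ⊔ ⊤ * G) hy hz
        algebraMap_mem' := by
          intro r
          rw [Algebra.algebraMap_eq_smul_one, ← hf.sum_one]
          exact Submodule.smul_mem _ _ (Submodule.mem_sup_left
            (Submodule.sum_mem _ fun i _ => Submodule.subset_span (Set.mem_range_self i))) }
    refine Submodule.eq_top_iff'.2 fun y => mem_subalgebra_of_generators hφ S ?_ ?_ y
    · exact fun i => Submodule.mem_sup_left (S := T) (Submodule.subset_span (Set.mem_range_self i))
    · exact fun a => Submodule.mem_sup_right (T := ⊤ * G)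
        (hle (Submodule.subset_span (Set.mem_range_self a)))

end Presentation
/-! ## The coordinate ring of a representation variety -/

section Geometry

variable {Q} {A : Type} [Ring A] [Algebra K A] {φ : PathAlgebra K Q →ₐ[K] A}

/-- The projection onto the block at the vertex `j`. -/
def blockProj (S : Type) [CommRing S] (d : Q.V → ℕ) (j : Q.V) :
    Matrix (RepIx Q d) (RepIx Q d) S :=
  Matrix.diagonal fun u => if u.1 = j then 1 else 0

theorem blockProj_map {S T : Type} [CommRing S] [CommRing T] (d : Q.V → ℕ) (j : Q.V)
    (f : S →+* T) : (blockProj S d j).map f = blockProj T d j := by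
  rw [blockProj, blockProj, Matrix.diagonal_map (map_zero f)]
  congr 1
  ext u
  by_cases h : u.1 = j <;> simp [h]

theorem isPathFamily_blockProj {S : Type} [CommRing S] (d : Q.V → ℕ)
    (X : Q.A → Matrix (RepIx Q d) (RepIx Q d) S)
    (hX : ∀ a u v, X a u v ≠ 0 → u.1 = Q.tgt a ∧ v.1 = Q.src a) :
    IsPathFamily (blockProj S d) X where
  idem i := by
    rw [blockProj, Matrix.diagonal_mul_diagonal]
    congr 1
    ext u
    by_cases h : u.1 = i <;> simp [h]
  orth i j hij := by
    rw [blockProj, blockProj, Matrix.diagonal_mul_diagonal, ← Matrix.diagonal_zero]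
    congr 1
    ext u
    by_cases h : u.1 = i
    · simp [h, hij]
    · simp [h]
  sum_one := by
    ext u v
    rw [Matrix.sum_apply]
    by_cases h : u = v
    · subst h
      simp [blockProj]
    · simp [blockProj, h]
  tgt_mul a := by
    ext u v
    rw [blockProj, Matrix.diagonal_mul]
    by_cases h : X a u v = 0
    · rw [h, mul_zero]
    · rw [if_pos (hX a u v h).1, one_mul]
  mul_src a := by
    ext u v
    rw [blockProj, Matrix.mul_diagonal]
    by_cases h : X a u v = 0
    · rw [h, zero_mul]
    · rw [if_pos (hX a u v h).2, mul_one]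

/-- The coordinates of a point of the representation space. -/
def repCoords (d : Q.V → ℕ) (x : RepSpace K Q d) : Q.A × RepIx Q d × RepIx Q d → K :=
  fun t => x t.1 t.2.1 t.2.2

/-- The ideal of polynomials vanishing on a set of points of the representation space. -/
def repIdeal (d : Q.V → ℕ) (X : Set (RepSpace K Q d)) :
    Ideal (MvPolynomial (Q.A × RepIx Q d × RepIx Q d) K) :=
  MvPolynomial.vanishingIdeal K (repCoords d '' X)

theorem mem_repIdeal_iff {d : Q.V → ℕ} {X : Set (RepSpace K Q d)}
    {f : MvPolynomial (Q.A × RepIx Q d × RepIx Q d) K} :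
    f ∈ repIdeal d X ↔ ∀ x ∈ X, MvPolynomial.aeval (repCoords d x) f = 0 := by
  rw [repIdeal, MvPolynomial.mem_vanishingIdeal_iff, Set.forall_mem_image]

theorem isOpen_setOf_aeval_ne_zero {d : Q.V → ℕ}
    (f : MvPolynomial (Q.A × RepIx Q d × RepIx Q d) K) :
    @IsOpen _ (repTopology K Q d)
      {x | MvPolynomial.aeval (repCoords d x) f ≠ 0} := by
  refine ⟨{y | MvPolynomial.eval y f ≠ 0}, TopologicalSpace.GenerateOpen.basic _ ⟨f, rfl⟩, ?_⟩
  ext x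
  simp only [MvPolynomial.aeval_eq_eval]
  rfl

theorem isPrime_repIdeal {d : Q.V → ℕ} {X : Set (RepSpace K Q d)}
    (hX : @IsIrreducible _ (repTopology K Q d) X) : (repIdeal d X).IsPrime := by
  obtain ⟨⟨x, hx⟩, hX⟩ := hX
  refine ⟨fun h => ?_, fun {f g} hfg => ?_⟩
  · have := mem_repIdeal_iff.1 ((Ideal.eq_top_iff_one _).1 h) x hx
    simp at this
  · by_contra! h
    obtain ⟨hf, hg⟩ := h
    rw [mem_repIdeal_iff] at hf hg
    push Not at hf hg
    obtain ⟨y, hy, hyf⟩ := hf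
    obtain ⟨z, hz, hzg⟩ := hg
    obtain ⟨w, hw, hwf, hwg⟩ := @hX _ _ (isOpen_setOf_aeval_ne_zero f)
      (isOpen_setOf_aeval_ne_zero g) ⟨y, hy, hyf⟩ ⟨z, hz, hzg⟩
    have := mem_repIdeal_iff.1 hfg w hw
    rw [map_mul] at this
    exact (mul_ne_zero hwf hwg) this

/-- The generic representation over the coordinate ring of an irreducible representation
variety, specializing to every point. -/
theorem exists_generic_representation (hadm : IsAdmissiblePresentation K Q φ) (d : Q.V → ℕ)
    (hX : @IsIrreducible _ (repTopology K Q d) (RepSet K Q φ d)) :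
    ∃ (R : Type) (_ : CommRing R) (_ : IsDomain R) (_ : IsNoetherianRing R) (_ : Algebra K R)
      (Φ : A →ₐ[K] Matrix (RepIx Q d) (RepIx Q d) R),
      ∀ x ∈ RepSet K Q φ d, ∃ ε : R →ₐ[K] K,
        (∀ i, (Φ (φ (vertexElem K Q i))).map ε = blockProj K d i) ∧
        ∀ a, (Φ (φ (arrowElem K Q a))).map ε = x a := by
  set I := repIdeal d (RepSet K Q φ d) with hI
  have hprime : I.IsPrime := isPrime_repIdeal hX
  let R := MvPolynomial (Q.A × RepIx Q d × RepIx Q d) K ⧸ I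
  let ev : ∀ x ∈ RepSet K Q φ d, R →ₐ[K] K := fun x hx =>
    Ideal.Quotient.liftₐ I (MvPolynomial.aeval (repCoords d x)) fun f hf =>
      mem_repIdeal_iff.1 hf x hx
  have hev : ∀ r : R, (∀ x (hx : x ∈ RepSet K Q φ d), ev x hx r = 0) → r = 0 := by
    intro r hr
    obtain ⟨f, rfl⟩ := Ideal.Quotient.mk_surjective r
    exact Ideal.Quotient.eq_zero_iff_mem.2 (mem_repIdeal_iff.2 fun x hx => hr x hx)
  let X : Q.A → Matrix (RepIx Q d) (RepIx Q d) R := fun a u v =>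
    Ideal.Quotient.mk I (MvPolynomial.X (a, u, v))
  have hXev : ∀ a x hx, (X a).map (ev x hx) = x a := by
    intro a x hx
    ext u v
    change MvPolynomial.aeval (repCoords d x) (MvPolynomial.X (a, u, v)) = x a u v
    rw [MvPolynomial.aeval_X]
    rfl
  obtain ⟨Φ, hΦv, hΦa⟩ := exists_algHom_of_relations hadm (isPathFamily_blockProj d X (by
      intro a u v hne
      by_contra hcon
      refine hne (hev _ fun x hx => ?_)
      have : ev x hx (X a u v) = x a u v := congrFun (congrFun (hXev a x hx) u) v
      rw [this]
      by_contra h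
      exact hcon (hx.1 a u v h))) (by
      intro c i j hc h0
      ext u v
      refine hev _ fun x hx => ?_
      have hmap : (ev x hx).mapMatrix (c.sum fun p l => l • (p.arrows.map X).prod) = 0 := by
        rw [← hx.2 c i j hc h0, map_finsuppSum, relEval]
        refine Finsupp.sum_congr fun p _ => ?_
        rw [map_smul, map_list_prod, List.map_map, pathProd]
        congr 3
        exact funext fun a => hXev a x hx
      exact congrFun (congrFun hmap u) v)
  refine ⟨R, inferInstance, inferInstance, inferInstance, inferInstance, Φ, fun x hx =>
    ⟨ev x hx, fun i => ?_, fun a => ?_⟩⟩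
  · rw [hΦv]
    exact blockProj_map d i (ev x hx).toRingHom
  · rw [hΦa, hXev a x hx]

/-- A matrix representation with the standard vertex idempotents is a point of the
representation variety. -/
theorem mem_repSet_of_algHom {d : Q.V → ℕ} (Ψ : A →ₐ[K] Matrix (RepIx Q d) (RepIx Q d) K)
    (hΨ : ∀ i, Ψ (φ (vertexElem K Q i)) = blockProj K d i) :
    (fun a => Ψ (φ (arrowElem K Q a))) ∈ RepSet K Q φ d := by
  have hf := isPathFamily_map (Ψ.comp φ)
  refine ⟨fun a u v h => ⟨?_, ?_⟩, fun c i j hc h0 => ?_⟩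
  · by_contra hne
    have := hf.tgt_mul a
    simp only [AlgHom.comp_apply, hΨ] at this
    refine h ((congrFun (congrFun this u) v).symm.trans ?_)
    rw [blockProj, Matrix.diagonal_mul, if_neg hne, zero_mul]
  · by_contra hne
    have := hf.mul_src a
    simp only [AlgHom.comp_apply, hΨ] at this
    refine h ((congrFun (congrFun this u) v).symm.trans ?_)
    rw [blockProj, Matrix.mul_diagonal, if_neg hne, mul_zero]
  · have := map_relElem (Ψ.comp φ) c
    rw [AlgHom.comp_apply, h0, map_zero] at this
    exact this.symm

/-- A generating property expressed by a nonvanishing determinant passes from any point of an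
irreducible representation variety to every point without deformations. -/
theorem exists_det_ne_zero_of_isIrreducible [Infinite K] [Module.Finite K A]
    (hadm : IsAdmissiblePresentation K Q φ) {d : Q.V → ℕ}
    (hX : @IsIrreducible _ (repTopology K Q d) (RepSet K Q φ d))
    {Ψ₁ Ψ₂ : A →ₐ[K] Matrix (RepIx Q d) (RepIx Q d) K}
    (h₁ : ∀ i, Ψ₁ (φ (vertexElem K Q i)) = blockProj K d i)
    (h₂ : ∀ i, Ψ₂ (φ (vertexElem K Q i)) = blockProj K d i)
    (hinner : DerivationsInner K Ψ₁) {Λ : Type} (β : RepIx Q d → A) (σ : RepIx Q d → Λ)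
    (v : Λ → RepIx Q d → K)
    (hv : (Matrix.of fun u s => (Ψ₂ (β s)).mulVec (v (σ s)) u).det ≠ 0) :
    ∃ w : Λ → RepIx Q d → K,
      (Matrix.of fun u s => (Ψ₁ (β s)).mulVec (w (σ s)) u).det ≠ 0 := by
  obtain ⟨R, _, _, _, _, Φ, hΦ⟩ := exists_generic_representation hadm d hX
  have key : ∀ Ψ : A →ₐ[K] Matrix (RepIx Q d) (RepIx Q d) K,
      (∀ i, Ψ (φ (vertexElem K Q i)) = blockProj K d i) →
      ∃ ε : R →ₐ[K] K, ∀ a, (Φ a).map ε = Ψ a := by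
    intro Ψ hΨ
    obtain ⟨ε, hv, ha⟩ := hΦ _ (mem_repSet_of_algHom Ψ hΨ)
    exact ⟨ε, fun a => DFunLike.congr_fun (algHom_ext_of_generators hadm.1
      (f := ε.mapMatrix.comp Φ) (g := Ψ) (fun i => (hv i).trans (hΨ i).symm) ha) a⟩
  obtain ⟨ε₁, hε₁⟩ := key Ψ₁ h₁
  obtain ⟨ε₂, hε₂⟩ := key Ψ₂ h₂
  refine exists_det_ne_zero_of_deformation hinner ε₁ Φ hε₁ β σ
    (fun l u => algebraMap K R (v l u)) fun h0 => hv ?_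
  have := congrArg ε₂ h0
  rw [map_zero, AlgHom.map_det] at this
  rw [← this]
  congr 1
  ext u s
  simp only [Matrix.of_apply, AlgHom.mapMatrix_apply, Matrix.map_apply, Matrix.mulVec, dotProduct,
    map_sum, map_mul, AlgHom.commutes, Algebra.algebraMap_self, RingHom.id_apply, ← hε₂]

end Geometry
/-! ## Absence of cycles through different vertices -/

section Cycles

variable {Q}

/-- There is an arrow between two different vertices. -/
def QuiverStep (i j : Q.V) : Prop :=
  ∃ a : Q.A, Q.src a = i ∧ Q.tgt a = j ∧ i ≠ j

variable {A : Type} [Ring A] [Algebra K A] {φ : PathAlgebra K Q →ₐ[K] A}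

theorem vertex_mul_mul_vertex_eq_zero (hφ : Function.Surjective φ) {i j : Q.V}
    (hij : ¬ Relation.ReflTransGen QuiverStep i j) (x : A) :
    φ (vertexElem K Q j) * x * φ (vertexElem K Q i) = 0 := by
  have hf := isPathFamily_map φ
  have horth : ∀ i j, ¬ Relation.ReflTransGen QuiverStep i j →
      φ (vertexElem K Q j) * φ (vertexElem K Q i) = 0 := fun i j h =>
    hf.orth j i fun hji => h (hji ▸ Relation.ReflTransGen.refl)
  let S : Subalgebra K A :=
    { carrier := {x | ∀ i j, ¬ Relation.ReflTransGen QuiverStep i j →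
        φ (vertexElem K Q j) * x * φ (vertexElem K Q i) = 0}
      mul_mem' := by
        intro x y hx hy i j h
        have : φ (vertexElem K Q j) * (x * y) * φ (vertexElem K Q i) =
            ∑ k, (φ (vertexElem K Q j) * x * φ (vertexElem K Q k)) *
              (φ (vertexElem K Q k) * y * φ (vertexElem K Q i)) := by
          calc φ (vertexElem K Q j) * (x * y) * φ (vertexElem K Q i)
              = φ (vertexElem K Q j) * (x * (∑ k, φ (vertexElem K Q k)) * y) *
                φ (vertexElem K Q i) := by rw [hf.sum_one, mul_one]
            _ = _ := by
              simp only [Finset.mul_sum, Finset.sum_mul]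
              refine Finset.sum_congr rfl fun k _ => ?_
              conv_lhs => rw [← hf.idem k]
              simp only [mul_assoc]
        rw [this]
        refine Finset.sum_eq_zero fun k _ => ?_
        by_cases hk : Relation.ReflTransGen QuiverStep i k
        · rw [hx k j fun h' => h (hk.trans h'), zero_mul]
        · rw [hy i k hk, mul_zero]
      add_mem' := by
        intro x y hx hy i j h
        rw [mul_add, add_mul, hx i j h, hy i j h, add_zero]
      algebraMap_mem' := by
        intro r i j h
        rw [mul_assoc, Algebra.commutes r, ← mul_assoc, horth i j h, zero_mul] }
  refine mem_subalgebra_of_generators hφ S ?_ ?_ x i j hij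
  · intro k i j h
    by_cases hk : j = k
    · rw [← hk, hf.idem, horth i j h]
    · rw [hf.orth j k hk, zero_mul]
  · intro a i j h
    rw [hf.vertex_mul_arrow]
    split_ifs with hj
    · rw [hf.arrow_mul_vertex]
      split_ifs with hi
      · exfalso
        by_cases hne : i = j
        · exact h (hne ▸ Relation.ReflTransGen.refl)
        · exact h (Relation.ReflTransGen.single ⟨a, hi.symm, hj.symm, hne⟩)
      · rfl
    · exact zero_mul _

/-- In the irreducible variety of thin representations some point has no vanishing arrow between
different vertices. -/
theorem exists_thin_representation (hirr : IsGeomIrreducible K Q φ) :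
    ∃ x ∈ RepSet K Q φ (fun _ => 1), ∀ a, Q.src a ≠ Q.tgt a →
      x a ⟨Q.tgt a, 0⟩ ⟨Q.src a, 0⟩ ≠ 0 := by
  classical
  have := isPrime_repIdeal (hirr fun _ => 1)
  have key : ∏ a ∈ Finset.univ.filter (fun a => Q.src a ≠ Q.tgt a),
      (MvPolynomial.X (a, ⟨Q.tgt a, 0⟩, ⟨Q.src a, 0⟩) :
        MvPolynomial (Q.A × RepIx Q (fun _ => 1) × RepIx Q (fun _ => 1)) K) ∉
      repIdeal (fun _ => 1) (RepSet K Q φ fun _ => 1) := by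
    rw [Ideal.IsPrime.prod_mem_iff]
    rintro ⟨a, ha, hmem⟩
    have ha' : Q.src a ≠ Q.tgt a := (Finset.mem_filter.1 ha).2
    let x : RepSpace K Q (fun _ => 1) := fun b => Matrix.of fun u v =>
      if b = a ∧ u.1 = Q.tgt a ∧ v.1 = Q.src a then 1 else 0
    have hxx : ∀ b b', x b * x b' = 0 := by
      intro b b'
      ext u v
      rw [Matrix.mul_apply]
      refine Finset.sum_eq_zero fun k _ => ?_
      simp only [x, Matrix.of_apply]
      split_ifs with h1 h2
      · exact absurd (h1.2.2.symm.trans h2.2.1) ha'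
      all_goals simp
    have hx : x ∈ RepSet K Q φ (fun _ => 1) := by
      refine ⟨fun b u v h => ?_, fun c i j hc _ => Finset.sum_eq_zero fun p hp => ?_⟩
      · simp only [x, Matrix.of_apply, ne_eq, ite_eq_right_iff, Classical.not_imp] at h
        rw [h.1.1]
        exact h.1.2
      · have h2 := (hc p hp).1
        rw [QPath.length] at h2
        change c p • (p.arrows.map x).prod = 0
        match hL : p.arrows, h2 with
        | b :: b' :: L, _ =>
          rw [List.map_cons, List.map_cons, List.prod_cons, List.prod_cons, ← mul_assoc, hxx,
            zero_mul, smul_zero]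
    have h0 := mem_repIdeal_iff.1 hmem x hx
    rw [MvPolynomial.aeval_X] at h0
    simp [repCoords, x] at h0
  rw [mem_repIdeal_iff] at key
  push Not at key
  obtain ⟨x, hx, hne⟩ := key
  refine ⟨x, hx, fun a ha => ?_⟩
  rw [map_prod, Finset.prod_ne_zero_iff] at hne
  have := hne a (Finset.mem_filter.2 ⟨Finset.mem_univ a, ha⟩)
  rw [MvPolynomial.aeval_X] at this
  exact this

theorem not_transGen_self (hadm : IsAdmissiblePresentation K Q φ)
    (hirr : IsGeomIrreducible K Q φ) (i : Q.V) : ¬ Relation.TransGen QuiverStep i i := by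
  intro hi
  obtain ⟨x, hx, hne⟩ := exists_thin_representation hirr
  obtain ⟨-, -, m, hm, hpath⟩ := hadm
  let P : ℕ → Q.V → Prop := fun n k => ∃ p : QPath Q, n ≤ p.length ∧ p.src = i ∧ p.tgt = k ∧
    pathProd K Q _ x p ⟨k, 0⟩ ⟨i, 0⟩ ≠ 0
  have hstep : ∀ n j k, P n j → QuiverStep j k → P (n + 1) k := by
    rintro n j k ⟨p, hn, hs, ht, hp⟩ ⟨a, rfl, rfl, ha⟩
    refine ⟨⟨a :: p.arrows, List.cons_ne_nil _ _, ?_⟩, ?_, ?_, rfl, ?_⟩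
    · refine List.isChain_cons.2 ⟨fun b hb => ?_, p.chain⟩
      rw [← ht, QPath.tgt]
      congr 1
      rw [List.head?_eq_some_head p.ne] at hb
      exact Option.some.inj hb
    · exact Nat.succ_le_succ hn
    · rw [← hs]
      simp [QPath.src, List.getLast_cons p.ne]
    · rw [pathProd, List.map_cons, List.prod_cons, Matrix.mul_apply,
        Finset.sum_eq_single ⟨Q.src a, 0⟩]
      · exact mul_ne_zero (hne a ha) hp
      · rintro ⟨k, l⟩ - hk
        have : x a ⟨Q.tgt a, 0⟩ ⟨k, l⟩ = 0 := by
          by_contra h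
          have hk' : k = Q.src a := (hx.1 a _ _ h).2
          subst hk'
          exact hk (by rw [Subsingleton.elim l 0])
        rw [this, zero_mul]
      · exact fun h => absurd (Finset.mem_univ _) h
  have hbase : ∀ k, QuiverStep i k → P 1 k := by
    rintro k ⟨a, rfl, rfl, ha⟩
    refine ⟨⟨[a], List.cons_ne_nil _ _, List.IsChain.singleton a⟩, le_rfl, rfl, rfl, ?_⟩
    rw [pathProd, List.map_singleton, List.prod_singleton]
    exact hne a ha
  have htrans : ∀ n j k, P n j → Relation.TransGen QuiverStep j k → P (n + 1) k := by
    intro n j k hj hjk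
    induction hjk with
    | single h => exact hstep n _ _ hj h
    | tail _ h ih =>
      obtain ⟨p, hp, hp'⟩ := hstep _ _ _ ih h
      exact ⟨p, by omega, hp'⟩
  have hreach : ∀ k, Relation.TransGen QuiverStep i k → P 1 k := by
    intro k hk
    induction hk with
    | single h => exact hbase _ h
    | tail _ h ih =>
      obtain ⟨p, hp, hp'⟩ := hstep _ _ _ ih h
      exact ⟨p, by omega, hp'⟩
  have hP : ∀ n, P (n + 1) i := by
    intro n
    induction n with
    | zero => exact hreach i hi
    | succ n ih => exact htrans _ _ _ ih hi
  obtain ⟨p, hp, hs, ht, h0⟩ := hP m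
  have hrel : relEval K Q _ x (Finsupp.single p 1) = 0 := by
    refine hx.2 _ i i (fun q hq => ?_) ?_
    · rw [Finsupp.mem_support_single] at hq
      rw [hq.1]
      exact ⟨by omega, ht, hs⟩
    · rw [relElem, Finsupp.sum_single_index (by rw [zero_smul]), one_smul]
      exact hpath p (by omega)
  rw [relEval, Finsupp.sum_single_index (by rw [zero_smul]), one_smul] at hrel
  exact h0 (congrFun (congrFun hrel _) _)

/-- Over a geometrically irreducible algebra there are no cycles through different vertices. -/
theorem vertex_cycle_eq_zero (hadm : IsAdmissiblePresentation K Q φ)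
    (hirr : IsGeomIrreducible K Q φ) {i j : Q.V} (hij : i ≠ j) (x y : A) :
    φ (vertexElem K Q i) * x * φ (vertexElem K Q j) *
      (φ (vertexElem K Q j) * y * φ (vertexElem K Q i)) = 0 := by
  by_cases h1 : Relation.ReflTransGen QuiverStep j i
  · by_cases h2 : Relation.ReflTransGen QuiverStep i j
    · rcases Relation.reflTransGen_iff_eq_or_transGen.1 h2 with h2 | h2
      · exact absurd h2.symm hij
      · exact absurd (h2.trans_left h1) (not_transGen_self hadm hirr i)
    · rw [vertex_mul_mul_vertex_eq_zero hadm.1 h2, mul_zero]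
  · rw [vertex_mul_mul_vertex_eq_zero hadm.1 h1, zero_mul]

/-- Compression to the corner at a vertex is multiplicative. -/
theorem vertex_compression_mul (hadm : IsAdmissiblePresentation K Q φ)
    (hirr : IsGeomIrreducible K Q φ) (i : Q.V) (x y : A) :
    φ (vertexElem K Q i) * (x * y) * φ (vertexElem K Q i) =
      φ (vertexElem K Q i) * x * φ (vertexElem K Q i) *
        (φ (vertexElem K Q i) * y * φ (vertexElem K Q i)) := by
  have hf := isPathFamily_map φ
  calc φ (vertexElem K Q i) * (x * y) * φ (vertexElem K Q i)
      = φ (vertexElem K Q i) * (x * (∑ k, φ (vertexElem K Q k)) * y) *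
        φ (vertexElem K Q i) := by rw [hf.sum_one, mul_one]
    _ = ∑ k, φ (vertexElem K Q i) * x * φ (vertexElem K Q k) *
        (φ (vertexElem K Q k) * y * φ (vertexElem K Q i)) := by
      simp only [Finset.mul_sum, Finset.sum_mul]
      refine Finset.sum_congr rfl fun k _ => ?_
      conv_lhs => rw [← hf.idem k]
      simp only [mul_assoc]
    _ = _ := Finset.sum_eq_single i
      (fun k _ hk => vertex_cycle_eq_zero hadm hirr (Ne.symm hk) x y)
      fun h => absurd (Finset.mem_univ i) h

end Cycles
/-! ## Adapted bases -/

section Adapted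

variable {Q} {A : Type} [Ring A] [Algebra K A] {φ : PathAlgebra K Q →ₐ[K] A}
  {N : Type} [AddCommGroup N] [Module K N]

/-- A basis of a representation that is compatible with the vertex idempotents. -/
def IsAdapted (φ : PathAlgebra K Q →ₐ[K] A) {d : Q.V → ℕ} (ρ : A →ₐ[K] Module.End K N)
    (B : Module.Basis (RepIx Q d) K N) : Prop :=
  ∀ j u, ρ (φ (vertexElem K Q j)) (B u) = if u.1 = j then B u else 0

theorem exists_isAdapted [Module.Finite K N] (φ : PathAlgebra K Q →ₐ[K] A)
    (ρ : A →ₐ[K] Module.End K N) :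
    ∃ B : Module.Basis (RepIx Q fun j =>
      Module.finrank K (LinearMap.range (ρ (φ (vertexElem K Q j))))) K N, IsAdapted φ ρ B := by
  have hf := isPathFamily_map (ρ.comp φ)
  let f : Q.V → Module.End K N := fun j => ρ (φ (vertexElem K Q j))
  have hidem : ∀ j x, f j (f j x) = f j x := fun j x => LinearMap.congr_fun (hf.idem j) x
  have horth : ∀ j k x, j ≠ k → f j (f k x) = 0 := fun j k x h =>
    LinearMap.congr_fun (hf.orth j k h) x
  have hone : ∀ x, ∑ j, f j x = x := fun x => by
    have := LinearMap.congr_fun hf.sum_one x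
    rwa [LinearMap.sum_apply] at this
  have hW : ∀ j k (y : LinearMap.range (f k)), f j y = if k = j then (y : N) else 0 := by
    rintro j k ⟨_, x, rfl⟩
    split_ifs with h
    · rw [h]
      exact hidem j x
    · exact horth j k x (Ne.symm h)
  let toPi : N →ₗ[K] ∀ j, LinearMap.range (f j) := LinearMap.pi fun j => (f j).rangeRestrict
  let ofPi : (∀ j, LinearMap.range (f j)) →ₗ[K] N :=
    ∑ j, (LinearMap.range (f j)).subtype ∘ₗ LinearMap.proj j
  have hofPi : ∀ y, ofPi y = ∑ j, (y j : N) := fun y => by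
    simp [ofPi, LinearMap.sum_apply]
  let E : N ≃ₗ[K] ∀ j, LinearMap.range (f j) := LinearEquiv.ofLinearMap toPi ofPi
    (LinearMap.ext fun y => funext fun j => Subtype.ext (by
      change f j (ofPi y) = y j
      rw [hofPi, map_sum]
      simp [hW]))
    (LinearMap.ext fun x => (hofPi _).trans (hone x))
  refine ⟨(Pi.basis fun j => Module.finBasis K (LinearMap.range (f j))).map E.symm,
    fun j u => ?_⟩
  have hB : ((Pi.basis fun j => Module.finBasis K (LinearMap.range (f j))).map E.symm) u =
      (Module.finBasis K (LinearMap.range (f u.1)) u.2 : N) := by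
    rw [Module.Basis.map_apply, Pi.basis_apply]
    refine (hofPi _).trans ?_
    rw [Finset.sum_eq_single u.1]
    · rw [Pi.single_eq_same]
    · intro k _ hk
      rw [Pi.single_eq_of_ne hk, Submodule.coe_zero]
    · exact fun h => absurd (Finset.mem_univ _) h
  rw [hB]
  exact hW j u.1 _

/-- Generating systems of a prescribed shape pass from an arbitrary representation to a
representation without deformations in the same irreducible variety. -/
theorem exists_span_eq_top_of_isIrreducible [Infinite K] [Module.Finite K A]
    (hadm : IsAdmissiblePresentation K Q φ) {d : Q.V → ℕ}
    (hX : @IsIrreducible _ (repTopology K Q d) (RepSet K Q φ d))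
    {N₁ N₂ : Type} [AddCommGroup N₁] [Module K N₁] [AddCommGroup N₂] [Module K N₂]
    {ρ₁ : A →ₐ[K] Module.End K N₁} {ρ₂ : A →ₐ[K] Module.End K N₂}
    {B₁ : Module.Basis (RepIx Q d) K N₁} {B₂ : Module.Basis (RepIx Q d) K N₂}
    (h₁ : IsAdapted φ ρ₁ B₁) (h₂ : IsAdapted φ ρ₂ B₂) (hinner : DerivationsInner K ρ₁)
    {Λ : Type} (β : RepIx Q d → A) (σ : RepIx Q d → Λ) (v : Λ → N₂)
    (hv : ∀ u, ρ₂ (β u) (v (σ u)) = B₂ u) :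
    ∃ w : Λ → N₁, Submodule.span K (Set.range fun u => ρ₁ (β u) (w (σ u))) = ⊤ := by
  have hproj : ∀ {N : Type} [AddCommGroup N] [Module K N] {ρ : A →ₐ[K] Module.End K N}
      {B : Module.Basis (RepIx Q d) K N}, IsAdapted φ ρ B → ∀ j,
      (LinearMap.toMatrixAlgEquiv B).toAlgHom.comp ρ (φ (vertexElem K Q j)) =
        blockProj K d j := by
    intro N _ _ ρ B h j
    ext u s
    change LinearMap.toMatrixAlgEquiv B (ρ (φ (vertexElem K Q j))) u s = _
    rw [LinearMap.toMatrixAlgEquiv_apply, h, blockProj, Matrix.diagonal_apply]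
    by_cases hus : u = s
    · subst hus
      by_cases hj : u.1 = j <;> simp [hj]
    · by_cases hj : s.1 = j <;> simp [hj, hus]
  obtain ⟨w, hw⟩ := exists_det_ne_zero_of_isIrreducible hadm hX (hproj h₁) (hproj h₂)
    (hinner.comp_equiv (LinearMap.toMatrixAlgEquiv B₁)) β σ (fun l => B₂.repr (v l)) (by
      have : (Matrix.of fun u s => ((LinearMap.toMatrixAlgEquiv B₂).toAlgHom.comp ρ₂
          (β s)).mulVec (B₂.repr (v (σ s))) u) = 1 := by
        ext u s
        rw [Matrix.of_apply]
        change (LinearMap.toMatrixAlgEquiv B₂ (ρ₂ (β s))).mulVec _ u = _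
        rw [LinearMap.toMatrixAlgEquiv, AlgEquiv.ofLinearEquiv_apply,
          LinearMap.toMatrix_mulVec_repr, hv, Module.Basis.repr_self, Finsupp.single_apply,
          Matrix.one_apply]
        simp only [eq_comm]
      rw [this, Matrix.det_one]
      exact one_ne_zero)
  refine ⟨fun l => B₁.equivFun.symm (w l), ?_⟩
  refine ((Module.Basis.is_basis_iff_det B₁).2 ?_).2
  rw [Module.Basis.det_apply, isUnit_iff_ne_zero]
  convert hw using 2
  ext u s
  rw [Matrix.of_apply, Module.Basis.toMatrix_apply]
  change _ = (LinearMap.toMatrixAlgEquiv B₁ (ρ₁ (β s))).mulVec _ u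
  have : w (σ s) = B₁.repr (B₁.equivFun.symm (w (σ s))) := by
    rw [← Module.Basis.equivFun_apply, LinearEquiv.apply_symm_apply]
  conv_rhs => rw [this]
  rw [LinearMap.toMatrixAlgEquiv, AlgEquiv.ofLinearEquiv_apply, LinearMap.toMatrix_mulVec_repr]

end Adapted
/-! ## Generators of the corner at a vertex -/

section Generators

variable {Q} {A : Type} [Ring A] [Algebra K A] {φ : PathAlgebra K Q →ₐ[K] A}

/-- The corner `eAe` as a subspace. -/
def cornerSubmodule (K : Type) [Field K] {A : Type} [Ring A] [Algebra K A] (e : A) :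
    Submodule K A where
  carrier := {x | e * x = x ∧ x * e = x}
  zero_mem' := ⟨mul_zero e, zero_mul e⟩
  add_mem' := fun {x y} hx hy => ⟨by rw [mul_add, hx.1, hy.1], by rw [add_mul, hx.2, hy.2]⟩
  smul_mem' := fun r x hx => ⟨by rw [mul_smul_comm, hx.1], by rw [smul_mul_assoc, hx.2]⟩

theorem mul_mul_mem_cornerSubmodule {e : A} (he : e * e = e) (x : A) :
    e * x * e ∈ cornerSubmodule K e :=
  ⟨by rw [← mul_assoc, ← mul_assoc, he], by rw [mul_assoc, he]⟩

theorem mul_mem_cornerSubmodule {e x y : A} (hx : x ∈ cornerSubmodule K e)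
    (hy : y ∈ cornerSubmodule K e) : x * y ∈ cornerSubmodule K e :=
  ⟨by rw [← mul_assoc, hx.1], by rw [mul_assoc, hy.2]⟩

theorem finrank_range_pi {M : Type} [AddCommGroup M] [Module K M] [Module.Finite K M]
    (f : Module.End K M) (c : ℕ) (F : Module.End K (Fin c → M)) (hF : ∀ y l, F y l = f (y l)) :
    Module.finrank K (LinearMap.range F) = c * Module.finrank K (LinearMap.range f) := by
  have hinj : Function.Injective ((LinearMap.range f).subtype.compLeft (Fin c)) := by
    intro y z h
    exact funext fun l => Subtype.ext (congrFun h l)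
  have hrange : LinearMap.range F =
      LinearMap.range ((LinearMap.range f).subtype.compLeft (Fin c)) := by
    ext y
    constructor
    · rintro ⟨z, rfl⟩
      exact ⟨fun l => ⟨f (z l), z l, rfl⟩, funext fun l => (hF z l).symm⟩
    · rintro ⟨z, rfl⟩
      choose x hx using fun l => (z l).2
      exact ⟨x, funext fun l => (hF x l).trans (hx l)⟩
  rw [hrange, LinearMap.finrank_range_of_inj hinj, Module.finrank_pi_fintype, Finset.sum_const,
    Finset.card_univ, Fintype.card_fin, smul_eq_mul]

/-- The representation that is a power of the corner at `i` and semisimple elsewhere. -/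
theorem exists_corner_representation (hadm : IsAdmissiblePresentation K Q φ)
    (hirr : IsGeomIrreducible K Q φ) (i : Q.V) (r : ℕ) (U : Type) (p : U → Q.V)
    {e : A} (hφe : φ (vertexElem K Q i) = e) :
    ∃ (ρ : A →ₐ[K] Module.End K ((Fin r → cornerSubmodule K e) × (U → K)))
      (χ : Q.V → A →ₐ[K] K),
      (∀ a n l, ((ρ a n).1 l : A) = e * a * e * (n.1 l : A)) ∧
      (∀ a n u, (ρ a n).2 u = χ (p u) a * n.2 u) ∧
      ∀ k j, χ k (φ (vertexElem K Q j)) = if j = k then 1 else 0 := by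
  choose χ hχ using fun j => exists_character hadm j
  have he : e * e = e := hφe ▸ (isPathFamily_map φ).idem i
  have hcomp := vertex_compression_mul hadm hirr i
  rw [hφe] at hcomp
  let C := cornerSubmodule K e
  let f : A →ₗ[K] Module.End K ((Fin r → C) × (U → K)) := LinearMap.mk₂ K
    (fun a n => (fun l => ⟨e * a * e * (n.1 l : A),
      mul_mem_cornerSubmodule (mul_mul_mem_cornerSubmodule he a) (n.1 l).2⟩,
      fun u => χ (p u) a * n.2 u))
    (fun a b n => by
      refine Prod.ext (funext fun l => Subtype.ext ?_) (funext fun u => ?_)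
      · simp [mul_add, add_mul]
      · simp [add_mul])
    (fun k a n => by
      refine Prod.ext (funext fun l => Subtype.ext ?_) (funext fun u => ?_)
      · simp
      · simp [mul_assoc])
    (fun a m n => by
      refine Prod.ext (funext fun l => Subtype.ext ?_) (funext fun u => ?_)
      · simp [mul_add]
      · simp [mul_add])
    (fun k a n => by
      refine Prod.ext (funext fun l => Subtype.ext ?_) (funext fun u => ?_)
      · simp
      · simp [mul_left_comm])
  have hf1 : ∀ a n l, ((f a n).1 l : A) = e * a * e * (n.1 l : A) := fun a n l => rfl
  have hf2 : ∀ a n u, (f a n).2 u = χ (p u) a * n.2 u := fun a n u => rfl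
  refine ⟨AlgHom.ofLinearMap f ?_ ?_, χ, fun a n l => rfl, fun a n u => rfl, hχ⟩
  · refine LinearMap.ext fun n => Prod.ext (funext fun l => Subtype.ext ?_) (funext fun u => ?_)
    · rw [hf1, mul_one, he, (n.1 l).2.1]
      rfl
    · rw [hf2, map_one, one_mul]
      rfl
  · intro a b
    refine LinearMap.ext fun n => Prod.ext (funext fun l => Subtype.ext ?_) (funext fun u => ?_)
    · rw [Module.End.mul_apply, hf1, hf1, hf1, hcomp, mul_assoc]
    · rw [Module.End.mul_apply, hf2, hf2, hf2, map_mul, mul_assoc]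

theorem exists_corner_generators [Infinite K] [Module.Finite K A]
    (hadm : IsAdmissiblePresentation K Q φ) (hirr : IsGeomIrreducible K Q φ)
    {M : Type} [AddCommGroup M] [Module K M] [Module A M] [IsScalarTower K A M]
    [Module.Finite K M] (hM : RigidModule A M) {i : Q.V} {e : A}
    (hφe : φ (vertexElem K Q i) = e) {c r : ℕ}
    (hc : Module.finrank K (cornerSubmodule K e) = c)
    (hr : Module.finrank K (LinearMap.range
      (Algebra.lsmul K K M e : Module.End K M)) = r) :
    ∃ w : Fin r → Fin c → M, ∀ z : Fin c → M, e • z = z →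
      ∃ α : Fin r → A, (∀ l, α l ∈ cornerSubmodule K e) ∧
        z = ∑ l, α l • w l := by
  have hpf := isPathFamily_map φ
  have he : e * e = e := hφe ▸ hpf.idem i
  have horth : ∀ j, i ≠ j → e * φ (vertexElem K Q j) = 0 := fun j h => hφe ▸ hpf.orth i j h
  let ρ₁ : A →ₐ[K] Module.End K (Fin c → M) := Algebra.lsmul K K (Fin c → M)
  obtain ⟨d, hdi, B₁, hB₁⟩ : ∃ d : Q.V → ℕ, d i = c * r ∧
      ∃ B : Module.Basis (RepIx Q d) K (Fin c → M), IsAdapted φ ρ₁ B := by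
    refine ⟨_, ?_, exists_isAdapted φ ρ₁⟩
    rw [← hr, hφe]
    exact finrank_range_pi _ c _ fun y l => rfl
  obtain ⟨ρ₂, χ, hρ₂1, hρ₂2, hχ⟩ := exists_corner_representation hadm hirr i r
    {u : RepIx Q d // ¬ u.1 = i} (fun u => u.1.1) hφe
  let b := Module.finBasisOfFinrankEq K (cornerSubmodule K e) hc
  let B₀ := (Pi.basis fun _ : Fin r => b).prod (Pi.basisFun K {u : RepIx Q d // ¬ u.1 = i})
  let E₀ : (Σ _ : Fin r, Fin c) ≃ {u : RepIx Q d // u.1 = i} :=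
    (Fintype.equivOfCardEq (by simp [hdi, mul_comm])).trans (Equiv.sigmaSubtype i).symm
  let E := (Equiv.sumCongr E₀ (Equiv.refl _)).trans (Equiv.sumCompl fun u : RepIx Q d => u.1 = i)
  have hE1 : ∀ p, (E (Sum.inl p)).1 = i := fun p => (E₀ p).2
  have hE2 : ∀ u, E (Sum.inr u) = u.1 := fun u => rfl
  have hB0l : ∀ p l, ((B₀ (Sum.inl p)).1 l : A) = if l = p.1 then (b p.2 : A) else 0 := by
    intro p l
    rw [Module.Basis.prod_apply_inl_fst, Pi.basis_apply, Pi.single_apply]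
    split_ifs <;> rfl
  have hB0l' : ∀ p, (B₀ (Sum.inl p)).2 = 0 := fun p => Module.Basis.prod_apply_inl_snd _ _ _
  have hB0r : ∀ u, (B₀ (Sum.inr u)).1 = 0 := fun u => Module.Basis.prod_apply_inr_fst _ _ _
  have hB0r' : ∀ u, (B₀ (Sum.inr u)).2 = Pi.single u 1 := fun u => by
    rw [Module.Basis.prod_apply_inr_snd, Pi.basisFun_apply]
  have hB₂ : IsAdapted φ ρ₂ (B₀.reindex E) := by
    intro j u
    obtain ⟨s, rfl⟩ := E.surjective u
    rw [Module.Basis.reindex_apply, Equiv.symm_apply_apply]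
    refine Prod.ext (funext fun l => Subtype.ext ?_) (funext fun u => ?_)
    · rw [hρ₂1]
      rcases s with p | u
      · rw [hE1]
        by_cases hj : i = j
        · rw [if_pos hj, ← hj, hφe, he, he, ((B₀ (Sum.inl p)).1 l).2.1]
        · rw [if_neg hj, horth j hj, zero_mul, zero_mul]
          rfl
      · split_ifs <;> simp [hB0r]
    · rw [hρ₂2, hχ]
      rcases s with p | u'
      · split_ifs <;> simp [hB0l']
      · rw [hE2, hB0r']
        by_cases hu : u = u'
        · subst hu
          by_cases hj : j = u.1.1
          · rw [if_pos hj, if_pos hj.symm, hB0r', one_mul]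
          · rw [if_neg hj, if_neg (Ne.symm hj), zero_mul]
            rfl
        · rw [Pi.single_eq_of_ne hu]
          split_ifs <;> simp [hB0r', hu]
  let β : RepIx Q d → A := fun u => Sum.elim (fun p => (b p.2 : A)) (fun _ => 1 - e) (E.symm u)
  let σ : RepIx Q d → Fin r ⊕ {u : RepIx Q d // ¬ u.1 = i} := fun u =>
    Sum.map Sigma.fst id (E.symm u)
  let one : cornerSubmodule K e := ⟨e, he, he⟩
  obtain ⟨w, hw⟩ := exists_span_eq_top_of_isIrreducible hadm (hirr d) hB₁ hB₂
    hM.derivationsInner.pi β σ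
    (Sum.elim (fun l => (Pi.single l one, 0)) (fun u => (0, Pi.single u 1))) (by
      intro u
      obtain ⟨s, rfl⟩ := E.surjective u
      simp only [β, σ, Module.Basis.reindex_apply, Equiv.symm_apply_apply]
      rcases s with p | u
      · refine Prod.ext (funext fun l => Subtype.ext ?_) (funext fun u => ?_)
        · rw [hρ₂1, hB0l]
          simp only [Sum.elim_inl, Sum.map_inl, Pi.single_apply]
          split_ifs
          · simp only [one]
            rw [(b p.2).2.1, (b p.2).2.2, (b p.2).2.2]
          · exact mul_zero _
        · rw [hρ₂2, hB0l']
          exact mul_zero _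
      · refine Prod.ext (funext fun l => Subtype.ext ?_) (funext fun u' => ?_)
        · rw [hρ₂1, hB0r]
          exact mul_zero _
        · rw [hρ₂2, hB0r']
          change χ u'.1.1 (1 - e) * (Pi.single u 1 : _ → K) u' = _
          rw [map_sub, map_one, ← hφe, hχ, if_neg (Ne.symm u'.2), sub_zero, one_mul])
  have key : ∀ z : Fin c → M, ∃ α : Fin r → A, (∀ l, α l ∈ cornerSubmodule K e) ∧
      e • z = ∑ l, α l • w (Sum.inl l) := by
    intro z
    have hz : z ∈ Submodule.span K (Set.range fun u => ρ₁ (β u) (w (σ u))) :=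
      hw ▸ Submodule.mem_top
    induction hz using Submodule.span_induction with
    | mem z hz =>
      obtain ⟨u, rfl⟩ := hz
      change ∃ α : Fin r → A, _ ∧ e • β u • w (σ u) = _
      obtain ⟨s, rfl⟩ := E.surjective u
      simp only [β, σ, Equiv.symm_apply_apply]
      rcases s with p | u
      · refine ⟨Pi.single p.1 (b p.2), fun l => ?_, ?_⟩
        · rw [Pi.single_apply]
          split_ifs
          · exact (b p.2).2
          · exact Submodule.zero_mem _
        · rw [Finset.sum_eq_single p.1]
          · rw [Pi.single_eq_same, smul_smul]
            change (e * (b p.2 : A)) • _ = _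
            rw [(b p.2).2.1]
            rfl
          · intro l _ hl
            rw [Pi.single_eq_of_ne hl, zero_smul]
          · exact fun h => absurd (Finset.mem_univ _) h
      · refine ⟨0, fun _ => Submodule.zero_mem _, ?_⟩
        change e • (1 - e) • _ = _
        rw [smul_smul, mul_sub, mul_one, he, sub_self, zero_smul]
        simp
    | zero => exact ⟨0, fun _ => Submodule.zero_mem _, by simp⟩
    | add y z _ _ ihy ihz =>
      obtain ⟨α, hα, hy⟩ := ihy
      obtain ⟨α', hα', hz⟩ := ihz
      refine ⟨α + α', fun l => Submodule.add_mem _ (hα l) (hα' l), ?_⟩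
      simp only [smul_add, hy, hz, Pi.add_apply, add_smul, Finset.sum_add_distrib]
    | smul k z _ ihz =>
      obtain ⟨α, hα, hz⟩ := ihz
      refine ⟨k • α, fun l => Submodule.smul_mem _ k (hα l), ?_⟩
      rw [smul_comm, hz, Finset.smul_sum]
      simp only [Pi.smul_apply, smul_assoc]
  exact ⟨fun l => w (Sum.inl l), fun z hz => hz ▸ key z⟩

end Generators
/-! ## Freeness over the corner -/

section Freeness

variable {Q} {A : Type} [Ring A] [Algebra K A] {φ : PathAlgebra K Q →ₐ[K] A}

/-- The corner at a vertex is local with nilpotent maximal ideal `J`. -/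
theorem exists_corner_radical (hadm : IsAdmissiblePresentation K Q φ) {i : Q.V} {e : A}
    (hφe : φ (vertexElem K Q i) = e) :
    ∃ J : Submodule K A, J ≤ cornerSubmodule K e ∧
      cornerSubmodule K e ≤ Submodule.span K {e} ⊔ J ∧ ∃ m : ℕ, J ^ m = ⊥ := by
  obtain ⟨H, hl, hr, ⟨m, hm⟩, htop⟩ := exists_radical hadm
  have hpf := isPathFamily_map φ
  have he : e * e = e := hφe ▸ hpf.idem i
  refine ⟨cornerSubmodule K e ⊓ H, inf_le_left, fun x hx => ?_, m, ?_⟩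
  · obtain ⟨s, hs, h, hh, hsh⟩ := Submodule.mem_sup.1 (htop ▸ Submodule.mem_top : x ∈ _ ⊔ H)
    have hxe : x = e * s * e + e * h * e := by
      rw [← add_mul, ← mul_add, hsh, hx.1, hx.2]
    rw [hxe]
    refine Submodule.add_mem_sup ?_ ⟨mul_mul_mem_cornerSubmodule he h,
      hr (Submodule.mul_mem_mul (hl (Submodule.mul_mem_mul Submodule.mem_top hh))
        Submodule.mem_top)⟩
    clear hxe hsh
    induction hs using Submodule.span_induction with
    | mem y hy =>
      obtain ⟨j, rfl⟩ := hy
      rw [← hφe]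
      by_cases hij : i = j
      · subst hij
        rw [hpf.idem, hpf.idem]
        exact Submodule.mem_span_singleton_self _
      · rw [hpf.orth i j hij, zero_mul]
        exact zero_mem _
    | zero => simp
    | add y z _ _ hy hz =>
      rw [mul_add, add_mul]
      exact add_mem hy hz
    | smul a y _ hy =>
      rw [mul_smul_comm, smul_mul_assoc]
      exact Submodule.smul_mem _ a hy
  · exact le_bot_iff.1 (hm ▸ pow_le_pow_left' inf_le_right m)

/-- Iterating `Y ≤ U ⊔ J • Y` for a nilpotent subspace `J` stabilizing `U`. -/
theorem le_of_le_sup_smul {M : Type} [AddCommGroup M] [Module K M] [Module A M]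
    [IsScalarTower K A M] {J : Submodule K A} {m : ℕ} (hJ : J ^ m = ⊥) {U Y : Submodule K M}
    (hU : J • U ≤ U) (hY : Y ≤ U ⊔ J • Y) : Y ≤ U := by
  have h : ∀ n : ℕ, Y ≤ U ⊔ J ^ n • Y := by
    intro n
    induction n with
    | zero => rw [pow_zero, Submodule.one_smul]; exact le_sup_right
    | succ n ih =>
      refine hY.trans (sup_le le_sup_left ?_)
      refine (Submodule.smul_mono le_rfl ih).trans ?_
      rw [Submodule.smul_sup, pow_succ', ← smul_eq_mul, Submodule.smul_assoc]
      exact sup_le_sup_right hU _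
  have := h m
  rwa [hJ, Submodule.bot_smul, sup_bot_eq] at this

theorem corner_free [Module.Finite K A] {e : A} (he : e * e = e) {J : Submodule K A}
    (hJC : J ≤ cornerSubmodule K e) (hCJ : cornerSubmodule K e ≤ Submodule.span K {e} ⊔ J)
    {m : ℕ} (hJm : J ^ m = ⊥)
    {M : Type} [AddCommGroup M] [Module K M] [Module A M] [IsScalarTower K A M]
    [Module.Finite K M] {c r : ℕ}
    (hc : Module.finrank K (cornerSubmodule K e) = c)
    (hr : Module.finrank K (LinearMap.range (Algebra.lsmul K K M e : Module.End K M)) = r)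
    {w : Fin r → Fin c → M}
    (hw : ∀ z : Fin c → M, e • z = z →
      ∃ α : Fin r → A, (∀ l, α l ∈ cornerSubmodule K e) ∧ z = ∑ l, α l • w l) :
    ∃ (t : ℕ) (y : Fin t → M), (∀ l, e • y l = y l) ∧
      (∀ n, e • n = n → ∃ α : Fin t → cornerSubmodule K e, n = ∑ l, (α l : A) • y l) ∧
      ∀ α : Fin t → cornerSubmodule K e, ∑ l, (α l : A) • y l = 0 → α = 0 := by
  set C := cornerSubmodule K e with hC
  set Y : Submodule K M := LinearMap.range (Algebra.lsmul K K M e : Module.End K M) with hYdef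
  have hY : ∀ n, n ∈ Y ↔ e • n = n := by
    intro n
    constructor
    · rintro ⟨n, rfl⟩
      simp only [Algebra.lsmul_coe, smul_smul, he]
    · intro h
      exact ⟨n, h⟩
  have heC : e ∈ C := ⟨he, he⟩
  have hCY : ∀ a ∈ C, ∀ n, a • n ∈ Y := fun a ha n => (hY _).2 (by rw [smul_smul, ha.1])
  set N := J • Y with hN
  let V := Y.map N.mkQ
  obtain ⟨t, b⟩ : ∃ t, Nonempty (Module.Basis (Fin t) K V) := ⟨_, ⟨Module.finBasis K V⟩⟩
  obtain ⟨b⟩ := b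
  choose y hyY hyb using fun l => (b l).2
  have hct : c * t ≤ r := by
    have ht : Module.finrank K V = t := by
      rw [Module.finrank_eq_card_basis b, Fintype.card_fin]
    let f : (Fin r → K) →ₗ[K] (Fin c → V) := Fintype.linearCombination K
      (fun l s => (⟨N.mkQ (e • w l s), _, hCY e heC _, rfl⟩ : V))
    have hf : Function.Surjective f := by
      intro z
      choose z' hz' hzz using fun s => (z s).2
      obtain ⟨α, hα, hzα⟩ := hw z' (funext fun s => (hY _).1 (hz' s))
      have hdec : ∀ l, ∃ (k : K), ∃ j ∈ J, α l = k • e + j := by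
        intro l
        obtain ⟨p, hp, j, hj, h⟩ := Submodule.mem_sup.1 (hCJ (hα l))
        obtain ⟨k, rfl⟩ := Submodule.mem_span_singleton.1 hp
        exact ⟨k, j, hj, h.symm⟩
      choose k j hj hk using hdec
      refine ⟨k, funext fun s => Subtype.ext ?_⟩
      rw [← hzz s, hzα]
      simp only [f, Fintype.linearCombination_apply, Finset.sum_apply, Pi.smul_apply,
        AddSubmonoidClass.coe_finsetSum, Submodule.coe_smul, map_sum]
      refine Finset.sum_congr rfl fun l _ => ?_
      rw [← map_smul, ← sub_eq_zero, ← map_sub, Submodule.mkQ_apply,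
        Submodule.Quotient.mk_eq_zero]
      have : k l • e • w l s - α l • w l s = -(j l • e • w l s) := by
        have h1 : α l • w l s = α l • e • w l s := by rw [smul_smul, (hα l).2]
        rw [h1, hk l, add_smul, smul_assoc, smul_smul e e, he]
        abel
      rw [this]
      exact neg_mem (Submodule.smul_mem_smul (hj l) (hCY e heC _))
    have := LinearMap.finrank_le_finrank_of_surjective hf
    rwa [Module.finrank_pi_fintype, Finset.sum_const, Finset.card_univ, Fintype.card_fin,
      ht, Module.finrank_pi, Fintype.card_fin, smul_eq_mul] at this
  let ψ : (Fin t → C) →ₗ[K] M :=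
    { toFun := fun α => ∑ l, (α l : A) • y l
      map_add' := fun α β => by
        simp only [Pi.add_apply, Submodule.coe_add, add_smul, Finset.sum_add_distrib]
      map_smul' := fun k α => by
        simp only [Pi.smul_apply, Submodule.coe_smul, smul_assoc, Finset.smul_sum,
          RingHom.id_apply] }
  have hψ : ∀ α, ψ α = ∑ l, (α l : A) • y l := fun _ => rfl
  have hYy : ∀ l, e • y l = y l := fun l => (hY _).1 (hyY l)
  have hyψ : ∀ l, y l ∈ LinearMap.range ψ := by
    intro l
    refine ⟨Pi.single l ⟨e, heC⟩, ?_⟩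
    rw [hψ, Finset.sum_eq_single l]
    · rw [Pi.single_eq_same]; exact hYy l
    · intro l' _ h
      rw [Pi.single_eq_of_ne h]; exact zero_smul A _
    · simp
  have hle : Y ≤ LinearMap.range ψ := by
    refine le_of_le_sup_smul hJm (Submodule.smul_le.2 ?_) ?_
    · rintro j hj _ ⟨α, rfl⟩
      refine ⟨fun l => ⟨j * α l, mul_mem_cornerSubmodule (hJC hj) (α l).2⟩, ?_⟩
      simp only [hψ, Finset.smul_sum, smul_smul]
    · intro n hn
      have hs := b.sum_repr ⟨N.mkQ n, n, hn, rfl⟩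
      set k := b.repr ⟨N.mkQ n, n, hn, rfl⟩
      have hmem : n - ∑ l, k l • y l ∈ N := by
        rw [← Submodule.Quotient.mk_eq_zero, ← Submodule.mkQ_apply, map_sub, map_sum,
          sub_eq_zero]
        have := congrArg Subtype.val hs
        simp only [AddSubmonoidClass.coe_finsetSum, Submodule.coe_smul] at this
        rw [← this]
        exact Finset.sum_congr rfl fun l _ => by rw [map_smul, hyb]
      rw [← add_sub_cancel (∑ l, k l • y l) n]
      exact Submodule.add_mem_sup
        (Submodule.sum_mem _ fun l _ => Submodule.smul_mem _ _ (hyψ l)) hmem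
  have hker : LinearMap.ker ψ = ⊥ := by
    have h1 := LinearMap.finrank_range_add_finrank_ker ψ
    have h2 := Submodule.finrank_mono hle
    rw [Module.finrank_pi_fintype, Finset.sum_const, Finset.card_univ, Fintype.card_fin,
      smul_eq_mul, hc, mul_comm] at h1
    rw [hr] at h2
    exact Submodule.finrank_eq_zero.1 (by omega)
  refine ⟨t, y, hYy, fun n hn => ?_, fun α hα => ?_⟩
  · obtain ⟨α, hα⟩ := hle ((hY n).2 hn)
    exact ⟨α, hα.symm⟩
  · exact LinearMap.ker_eq_bot'.1 hker α hα

/-- A module over a corner ring with a finite basis, given by elements of `M`, is free. -/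
theorem cornerMod_free_of_basis (K : Type) [Field K] [Algebra K A] {ε : IdemElem A}
    {M : Type} [AddCommGroup M] [Module A M]
    {t : ℕ} {y : Fin t → M} (hy : ∀ l, ε.e • y l = y l)
    (hspan : ∀ n, ε.e • n = n →
      ∃ α : Fin t → cornerSubmodule K ε.e, n = ∑ l, (α l : A) • y l)
    (hindep : ∀ α : Fin t → cornerSubmodule K ε.e, ∑ l, (α l : A) • y l = 0 → α = 0) :
    Module.Free (Corner ε) (CornerMod ε M) := by
  let v : Fin t → CornerMod ε M := fun l => ⟨y l, hy l⟩
  let val : CornerMod ε M →+ M := ⟨⟨Subtype.val, rfl⟩, fun _ _ => rfl⟩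
  have hval : ∀ α : Fin t → Corner ε, (∑ l, α l • v l).1 = ∑ l, (α l).1 • y l :=
    fun α => map_sum val _ _
  have hli : LinearIndependent (Corner ε) v := by
    rw [Fintype.linearIndependent_iff]
    intro α hα l
    have h := hindep (fun l => ⟨(α l).1, (α l).2⟩) (by rw [← hval, hα]; rfl)
    exact Subtype.ext (congrArg Subtype.val (congrFun h l))
  refine Module.Free.of_basis (Module.Basis.mk hli fun n _ => ?_)
  obtain ⟨α, hα⟩ := hspan n.1 n.2
  let β : Fin t → Corner ε := fun l => ⟨(α l).1, (α l).2⟩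
  have hn : n = ∑ l, β l • v l := Subtype.ext (by rw [hval]; exact hα)
  rw [hn]
  exact Submodule.sum_mem _ fun l _ =>
    Submodule.smul_mem _ _ (Submodule.subset_span ⟨l, rfl⟩)

end Freeness

variable (K)

/-- Let `A = KQ/I` be a geometrically irreducible finite-dimensional
algebra over an algebraically closed field `K` (with `I` admissible).  Then every rigid
finite-dimensional `A`-module is locally free: if `Ext¹_A(M,M) = 0` then `eᵢM` is a free
`eᵢAeᵢ`-module for every vertex `i` of `Q`. -/
theorem rigid_module_is_locally_free [IsAlgClosed K]
    (A : Type) [Ring A] [Algebra K A] [Module.Finite K A]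
    (φ : PathAlgebra K Q →ₐ[K] A) (hadm : IsAdmissiblePresentation K Q φ)
    (hirr : IsGeomIrreducible K Q φ)
    (M : Type) [AddCommGroup M] [Module K M] [Module A M] [IsScalarTower K A M]
    [Module.Finite K M] (hM : RigidModule A M) :
    IsLocallyFree K Q φ M := by
  intro i
  obtain ⟨w, hw⟩ := exists_corner_generators hadm hirr hM (i := i) rfl rfl rfl
  obtain ⟨J, hJC, hCJ, m, hJm⟩ := exists_corner_radical hadm (i := i) rfl
  obtain ⟨t, y, hy, hspan, hindep⟩ :=
    corner_free (vertexIdem K Q φ i).idem hJC hCJ hJm rfl rfl hw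
  exact cornerMod_free_of_basis K hy hspan hindep
end
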